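/- arXiv:math-ph/0605039 — 2 statements merged into one kernel-verified Lean document; each statement's English description precedes it below -/
import Mathlib

section
/- (Mostow decomposition of GL₂(H).) Let E be a closed real-linear subspace of S₂(H) such that [X, [X, Y]] ∈ E for all X, Y ∈ E, and let F = E^⊥ be the orthogonal complement of E in S₂(H) with respect to the Hilbert–Schmidt inner product. Then for every x ∈ GL₂(H) there exist a unique k ∈ U₂(H), a unique f ∈ exp F and a unique e ∈ exp E such that x = k f e; moreover, the map (k, f, e) ↦ k f e is a homeomorphism from U₂(H) × exp F × exp E onto GL₂(H), all spaces being topologized by the Hilbert–Schmidt distance (x, y) ↦ ‖x − y‖₂. -/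
noncomputable section

open scoped InnerProductSpace

variable {H : Type*} [NormedAddCommGroup H] [InnerProductSpace ℂ H] [CompleteSpace H]
variable {ι : Type*}

/-- `A` is a Hilbert–Schmidt operator (w.r.t. the Hilbert basis `e`). -/
def IsHS (e : HilbertBasis ι ℂ H) (A : H →L[ℂ] H) : Prop :=
  Summable fun i => ‖A (e i)‖ ^ 2

/-- The Hilbert–Schmidt norm of `A` (w.r.t. the Hilbert basis `e`). -/
def hsNorm (e : HilbertBasis ι ℂ H) (A : H →L[ℂ] H) : ℝ :=
  Real.sqrt (∑' i, ‖A (e i)‖ ^ 2)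

/-- The real Hilbert–Schmidt inner product `⟨A, B⟩₂ = ∑ ⟪A eᵢ, B eᵢ⟫`. -/
def hsInner (e : HilbertBasis ι ℂ H) (A B : H →L[ℂ] H) : ℝ :=
  (∑' i, (inner ℂ (A (e i)) (B (e i)) : ℂ)).re

/-- The trace of an operator, `Tr T = ∑ ⟪eᵢ, T eᵢ⟫`. -/
def opTrace (e : HilbertBasis ι ℂ H) (T : H →L[ℂ] H) : ℂ :=
  ∑' i, (inner ℂ (e i) (T (e i)) : ℂ)

/-- `T` is trace class: it is the product of two Hilbert–Schmidt operators. -/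
def IsTraceClass (e : HilbertBasis ι ℂ H) (T : H →L[ℂ] H) : Prop :=
  ∃ B C : H →L[ℂ] H, IsHS e B ∧ IsHS e C ∧ T = B * C

/-- `A ∈ S₂(H)`: self-adjoint and Hilbert–Schmidt. -/
def MemS2 (e : HilbertBasis ι ℂ H) (A : H →L[ℂ] H) : Prop :=
  IsSelfAdjoint A ∧ IsHS e A

/-- `p ∈ P`: self-adjoint, positive definite (invertible and `⟪p x, x⟫ ≥ 0`),
with `p - 1` Hilbert–Schmidt. -/
def MemP (e : HilbertBasis ι ℂ H) (p : H →L[ℂ] H) : Prop :=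
  IsSelfAdjoint p ∧ IsUnit p ∧ (∀ x : H, 0 ≤ (inner ℂ (p x) x : ℂ).re) ∧ IsHS e (p - 1)

/-- `x ∈ GL₂(H)`: invertible with `x - 1` Hilbert–Schmidt. -/
def MemGL2 (e : HilbertBasis ι ℂ H) (x : H →L[ℂ] H) : Prop :=
  IsUnit x ∧ IsHS e (x - 1)

/-- `x ∈ U₂(H)`: unitary with `x - 1` Hilbert–Schmidt. -/
def MemU2 (e : HilbertBasis ι ℂ H) (x : H →L[ℂ] H) : Prop :=
  x ∈ unitary (H →L[ℂ] H) ∧ IsHS e (x - 1)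

/-- `p^{1/2}`, via continuous functional calculus. -/
def psqrt (p : H →L[ℂ] H) : H →L[ℂ] H := cfc Real.sqrt p

/-- `p^{-1/2}`, via continuous functional calculus. -/
def pinvsqrt (p : H →L[ℂ] H) : H →L[ℂ] H := cfc (fun t : ℝ => (Real.sqrt t)⁻¹) p

/-- `log p`, via continuous functional calculus. -/
def plog (p : H →L[ℂ] H) : H →L[ℂ] H := cfc Real.log p

/-- The geodesic distance `d(p, q) = ‖log (p^{-1/2} q p^{-1/2})‖₂`. -/
def gdist (e : HilbertBasis ι ℂ H) (p q : H →L[ℂ] H) : ℝ :=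
  hsNorm e (plog (pinvsqrt p * q * pinvsqrt p))

/-- The commutator `[A, B] = AB - BA`. -/
def brk (A B : H →L[ℂ] H) : H →L[ℂ] H := A * B - B * A

/-- The constant-speed geodesic `t ↦ p^{1/2} exp(t K) p^{1/2}`. -/
def geoCurve (p K : H →L[ℂ] H) (t : ℝ) : H →L[ℂ] H :=
  psqrt p * NormedSpace.exp (t • K) * psqrt p

/-- The geodesic from `p` to `q`:
`t ↦ p^{1/2} exp(t log(p^{-1/2} q p^{-1/2})) p^{1/2}`. -/
def geodesic (p q : H →L[ℂ] H) (t : ℝ) : H →L[ℂ] H :=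
  geoCurve p (plog (pinvsqrt p * q * pinvsqrt p)) t

/-- The image `exp E` of a set of operators under the exponential map. -/
def expSet (E : Set (H →L[ℂ] H)) : Set (H →L[ℂ] H) := NormedSpace.exp '' E

/-- The orthogonal complement of `E` inside `S₂(H)` for the Hilbert–Schmidt
inner product. -/
def hsPerp (e : HilbertBasis ι ℂ H) (E : Set (H →L[ℂ] H)) : Set (H →L[ℂ] H) :=
  {Y | MemS2 e Y ∧ ∀ X ∈ E, hsInner e X Y = 0}

/-- `E` is closed in `S₂(H)` with respect to the Hilbert–Schmidt norm. -/
def IsHSClosed (e : HilbertBasis ι ℂ H) (E : Set (H →L[ℂ] H)) : Prop :=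
  ∀ X : H →L[ℂ] H, MemS2 e X → (∀ ε > (0:ℝ), ∃ Y ∈ E, hsNorm e (X - Y) < ε) → X ∈ E

set_option linter.unusedSectionVars false
set_option linter.unusedSimpArgs false
set_option linter.deprecated false
set_option linter.unusedVariables false

section Part1
section HSpace

/-- The space of Hilbert–Schmidt operators, modelled on square-summable families. -/
def HSp (_e : HilbertBasis ι ℂ H) : Type _ := lp (fun _ : ι => H) 2

instance (e : HilbertBasis ι ℂ H) : NormedAddCommGroup (HSp e) :=
  inferInstanceAs (NormedAddCommGroup (lp (fun _ : ι => H) 2))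

instance (e : HilbertBasis ι ℂ H) : InnerProductSpace ℝ (HSp e) :=
  InnerProductSpace.rclikeToReal ℂ (lp (fun _ : ι => H) 2)

instance (e : HilbertBasis ι ℂ H) : CompleteSpace (HSp e) :=
  inferInstanceAs (CompleteSpace (lp (fun _ : ι => H) 2))

variable {e : HilbertBasis ι ℂ H}

/-- coordinates -/
def HSp.co (v : HSp e) (i : ι) : H := (show lp (fun _ : ι => H) 2 from v) i

lemma HSp.co_add (v w : HSp e) (i : ι) : (v + w).co i = v.co i + w.co i := rfl
lemma HSp.co_smul (c : ℝ) (v : HSp e) (i : ι) : (c • v).co i = (c : ℂ) • v.co i := rfl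

lemma HSp.ext_co {v w : HSp e} (h : ∀ i, v.co i = w.co i) : v = w :=
  lp.ext (funext h)

lemma HSp.summable_sq (v : HSp e) : Summable fun i => ‖v.co i‖ ^ 2 := by
  have := (lp.memℓp (show lp (fun _ : ι => H) 2 from v)).summable (by norm_num)
  simp only [ENNReal.toReal_ofNat, Real.rpow_ofNat] at this
  exact this

lemma HSp.norm_sq (v : HSp e) : ‖v‖ ^ 2 = ∑' i, ‖v.co i‖ ^ 2 := by
  have := lp.norm_rpow_eq_tsum (p := 2) (by norm_num) (show lp (fun _ : ι => H) 2 from v)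
  simp only [ENNReal.toReal_ofNat, Real.rpow_ofNat] at this
  exact this

lemma HSp.inner_eq (v w : HSp e) :
    ⟪v, w⟫_ℝ = (∑' i, (inner ℂ (v.co i) (w.co i) : ℂ)).re := rfl

lemma HSp.hasSum_inner (v w : HSp e) :
    HasSum (fun i => ((inner ℂ (v.co i) (w.co i) : ℂ)).re) ⟪v, w⟫_ℝ :=
  (Complex.hasSum_re (lp.hasSum_inner (𝕜 := ℂ) (show lp (fun _ : ι => H) 2 from v) w))

lemma basis_norm_sq (e : HilbertBasis ι ℂ H) (x : H) :
    HasSum (fun i => ‖(inner ℂ (e i) x : ℂ)‖ ^ 2) (‖x‖ ^ 2) := by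
  have := e.hasSum_inner_mul_inner x x
  have h2 := Complex.hasSum_re this
  have h3 : ∀ i, (inner ℂ x (e i) * inner ℂ (e i) x : ℂ).re = ‖(inner ℂ (e i) x : ℂ)‖ ^ 2 := by
    intro i
    rw [← inner_conj_symm x (e i), Complex.conj_mul']
    norm_cast
  simp only [h3] at h2
  convert h2 using 1
  exact norm_sq_eq_re_inner (𝕜 := ℂ) x

lemma HSp.summable_term (v : HSp e) (x : H) :
    Summable fun i => ‖(inner ℂ (e i) x : ℂ) • v.co i‖ := by
  refine Summable.of_nonneg_of_le (fun _ => norm_nonneg _) (fun i => ?_)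
    ((basis_norm_sq e x).summable.add v.summable_sq)
  rw [norm_smul]
  nlinarith [sq_nonneg (‖(inner ℂ (e i) x : ℂ)‖ - ‖v.co i‖), sq_nonneg (‖(inner ℂ (e i) x : ℂ)‖),
    sq_nonneg (‖v.co i‖)]

lemma HSp.norm_tsum_le (v : HSp e) (x : H) :
    ‖∑' i, (inner ℂ (e i) x : ℂ) • v.co i‖ ≤ ‖v‖ * ‖x‖ := by
  refine (norm_tsum_le_tsum_norm (v.summable_term x)).trans ?_
  refine (v.summable_term x).tsum_le_of_sum_le fun s => ?_
  simp_rw [norm_smul]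
  refine (Real.sum_mul_le_sqrt_mul_sqrt s _ _).trans ?_
  rw [mul_comm]
  gcongr
  · refine Real.sqrt_le_iff.2 ⟨norm_nonneg _, ?_⟩
    rw [v.norm_sq]
    exact v.summable_sq.sum_le_tsum _ (fun _ _ => by positivity)
  · refine Real.sqrt_le_iff.2 ⟨norm_nonneg _, ?_⟩
    exact sum_le_hasSum _ (fun _ _ => by positivity) (basis_norm_sq e x)

/-- the operator attached to an element of `HSp` -/
def HSp.op : HSp e →L[ℝ] (H →L[ℂ] H) :=
  LinearMap.mkContinuous
    { toFun := fun v => LinearMap.mkContinuous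
        { toFun := fun x => ∑' i, (inner ℂ (e i) x : ℂ) • v.co i
          map_add' := fun x y => by
            simp only [inner_add_right, add_smul]
            exact (v.summable_term x).of_norm.tsum_add (v.summable_term y).of_norm
          map_smul' := fun c x => by
            simp only [inner_smul_right, mul_smul, RingHom.id_apply]
            exact (v.summable_term x).of_norm.tsum_const_smul c } ‖v‖ v.norm_tsum_le
      map_add' := fun v w => by
        ext x
        simp only [LinearMap.mkContinuous_apply, LinearMap.coe_mk, AddHom.coe_mk,
          HSp.co_add, smul_add, ContinuousLinearMap.add_apply]
        exact (v.summable_term x).of_norm.tsum_add (w.summable_term x).of_norm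
      map_smul' := fun c v => by
        ext x
        simp only [LinearMap.mkContinuous_apply, LinearMap.coe_mk, AddHom.coe_mk,
          HSp.co_smul, RingHom.id_apply, ContinuousLinearMap.smul_apply]
        have := (v.summable_term x).of_norm.tsum_const_smul (c : ℂ)
        rw [← Complex.coe_smul, ← this]
        congr 1; ext i
        rw [smul_comm] } 1 (fun v => by
      rw [one_mul]
      exact LinearMap.mkContinuous_norm_le _ (norm_nonneg _) v.norm_tsum_le)

lemma HSp.op_apply (v : HSp e) (x : H) : v.op x = ∑' i, (inner ℂ (e i) x : ℂ) • v.co i := rfl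

lemma HSp.op_basis (v : HSp e) (i : ι) : v.op (e i) = v.co i := by
  rw [op_apply, tsum_eq_single i]
  · simp [e.orthonormal.1 i]
  · intro j hj
    have := e.orthonormal.2 hj
    simp [this]

lemma HSp.norm_op_le (v : HSp e) : ‖v.op‖ ≤ ‖v‖ :=
  LinearMap.mkContinuous_norm_le _ (norm_nonneg _) v.norm_tsum_le

lemma op_ext_basis (e : HilbertBasis ι ℂ H) {A B : H →L[ℂ] H} (h : ∀ i, A (e i) = B (e i)) : A = B := by
  refine ContinuousLinearMap.ext_on (s := Set.range e) ?_ ?_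
  · have := e.dense_span
    rw [Submodule.dense_iff_topologicalClosure_eq_top]; exact this
  · rintro _ ⟨i, rfl⟩; exact h i

lemma HSp.op_injective : Function.Injective (HSp.op : HSp e → (H →L[ℂ] H)) := by
  intro v w h
  apply HSp.ext_co
  intro i
  rw [← op_basis, ← op_basis, h]

lemma HSp.isHS (v : HSp e) : IsHS e v.op := by
  unfold IsHS; simp only [op_basis]; exact v.summable_sq

lemma IsHS.exists_op {A : H →L[ℂ] H} (h : IsHS e A) : ∃ v : HSp e, v.op = A := by
  let v : HSp e := (⟨fun i => A (e i), memℓp_gen (by simpa [IsHS] using h)⟩ : lp (fun _ : ι => H) 2)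
  refine ⟨v, op_ext_basis e fun i => ?_⟩
  rw [HSp.op_basis]; rfl

lemma HSp.hsNorm_op (v : HSp e) : hsNorm e v.op = ‖v‖ := by
  unfold hsNorm; simp only [op_basis]; rw [← v.norm_sq, Real.sqrt_sq (norm_nonneg _)]

lemma HSp.hsInner_op (v w : HSp e) : hsInner e v.op w.op = ⟪v, w⟫_ℝ := by
  unfold hsInner; simp only [op_basis]; rfl

end HSpace
end Part1

section Part2
section HSpace2
variable {e : HilbertBasis ι ℂ H}

/-- the element of `HSp` attached to a Hilbert–Schmidt operator -/
def toHS (A : H →L[ℂ] H) (h : IsHS e A) : HSp e := Classical.choose h.exists_op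

lemma op_toHS (A : H →L[ℂ] H) (h : IsHS e A) : (toHS A h).op = A := Classical.choose_spec h.exists_op

lemma toHS_op (v : HSp e) : toHS v.op v.isHS = v := HSp.op_injective (op_toHS _ _)

lemma isHS_star_aux {A : H →L[ℂ] H} (h : IsHS e A) :
    IsHS e (star A) ∧ ∑' i, ‖(star A) (e i)‖ ^ 2 = ∑' i, ‖A (e i)‖ ^ 2 := by
  have key : ∀ i j, ‖(inner ℂ (e i) (A (e j)) : ℂ)‖ = ‖(inner ℂ (e j) (star A (e i)) : ℂ)‖ := by
    intro i j
    rw [ContinuousLinearMap.star_eq_adjoint, ContinuousLinearMap.adjoint_inner_right,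
      ← inner_conj_symm, RCLike.norm_conj]
  have h1 : Summable fun p : ι × ι => ‖(inner ℂ (e p.2) (A (e p.1)) : ℂ)‖ ^ 2 := by
    rw [summable_prod_of_nonneg (fun _ => by positivity)]
    refine ⟨fun i => (basis_norm_sq e (A (e i))).summable, ?_⟩
    simp only [(basis_norm_sq e (A (e _))).tsum_eq]
    exact h
  have h2 : Summable fun p : ι × ι => ‖(inner ℂ (e p.1) (A (e p.2)) : ℂ)‖ ^ 2 := h1.prod_symm
  have h3 := (summable_prod_of_nonneg (fun _ => by positivity)).1 h2
  simp only [key, (basis_norm_sq e (star A (e _))).tsum_eq] at h3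
  refine ⟨h3.2, ?_⟩
  have h4 := h2.tsum_prod
  have h5 := h1.tsum_prod
  simp only [(basis_norm_sq e (A (e _))).tsum_eq] at h5
  simp only [key, (basis_norm_sq e (star A (e _))).tsum_eq] at h4
  rw [← h4, ← h5]
  simp only [← key]
  exact (Equiv.prodComm ι ι).tsum_eq (fun p : ι × ι => ‖(inner ℂ (e p.2) (A (e p.1)) : ℂ)‖ ^ 2)

lemma IsHS.star' {A : H →L[ℂ] H} (h : IsHS e A) : IsHS e (star A) := (isHS_star_aux h).1

lemma IsHS.mul_left {A : H →L[ℂ] H} (h : IsHS e A) (a : H →L[ℂ] H) : IsHS e (a * A) := by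
  unfold IsHS at *
  refine Summable.of_nonneg_of_le (fun _ => by positivity) (fun i => ?_) (h.mul_left (‖a‖ ^ 2))
  rw [← mul_pow]
  exact pow_le_pow_left₀ (norm_nonneg _) (a.le_opNorm _) _

lemma IsHS.mul_right {A : H →L[ℂ] H} (h : IsHS e A) (a : H →L[ℂ] H) : IsHS e (A * a) := by
  have := ((h.star').mul_left (star a)).star'
  simpa using this

lemma HSp.norm_eq_sqrt (v : HSp e) : ‖v‖ = Real.sqrt (∑' i, ‖v.op (e i)‖ ^ 2) := (v.hsNorm_op).symm

/-- the adjoint on `HSp` -/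
def HSp.J (v : HSp e) : HSp e := toHS (star v.op) v.isHS.star'

lemma HSp.op_J (v : HSp e) : v.J.op = star v.op := op_toHS _ _

lemma HSp.norm_J (v : HSp e) : ‖v.J‖ = ‖v‖ := by
  rw [norm_eq_sqrt, norm_eq_sqrt, op_J, (isHS_star_aux v.isHS).2]

lemma HSp.J_J (v : HSp e) : v.J.J = v := op_injective (by simp [op_J])

lemma HSp.J_add (v w : HSp e) : (v + w).J = v.J + w.J := op_injective (by simp [op_J])
lemma HSp.J_sub (v w : HSp e) : (v - w).J = v.J - w.J := op_injective (by simp [op_J])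
lemma HSp.J_smul (c : ℝ) (v : HSp e) : (c • v).J = c • v.J := op_injective (by simp [op_J])

lemma HSp.inner_J (v w : HSp e) : ⟪v.J, w.J⟫_ℝ = ⟪v, w⟫_ℝ := by
  have h1 := real_inner_eq_norm_add_mul_self_sub_norm_mul_self_sub_norm_mul_self_div_two v.J w.J
  rw [h1, real_inner_eq_norm_add_mul_self_sub_norm_mul_self_sub_norm_mul_self_div_two v w,
    ← J_add, norm_J, norm_J, norm_J]

lemma HSp.norm_left_le (a : H →L[ℂ] H) (v : HSp e) :
    ‖toHS (a * v.op) (v.isHS.mul_left a)‖ ≤ ‖a‖ * ‖v‖ := by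
  refine abs_le_of_sq_le_sq' ?_ (by positivity) |>.2
  rw [mul_pow, norm_sq, norm_sq, ← tsum_mul_left]
  simp only [← op_basis, op_toHS]
  have h : ∀ i, ‖(a * v.op) (e i)‖ ^ 2 ≤ ‖a‖ ^ 2 * ‖v.op (e i)‖ ^ 2 := fun i => by
    rw [← mul_pow]
    exact pow_le_pow_left₀ (norm_nonneg _) (a.le_opNorm _) _
  exact (v.isHS.mul_left a).tsum_le_tsum h (Summable.mul_left _ v.isHS)

/-- left multiplication -/
def Lm (e : HilbertBasis ι ℂ H) : (H →L[ℂ] H) →L[ℝ] HSp e →L[ℝ] HSp e :=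
  LinearMap.mkContinuous₂
    (LinearMap.mk₂ ℝ (fun a v => toHS (a * v.op) (v.isHS.mul_left a))
      (fun a b v => HSp.op_injective (by simp [op_toHS, add_mul]))
      (fun c a v => HSp.op_injective (by simp [op_toHS]))
      (fun a v w => HSp.op_injective (by simp [op_toHS, mul_add]))
      (fun c a v => HSp.op_injective (by simp [op_toHS]))) 1
    (fun a v => by rw [one_mul]; exact HSp.norm_left_le a v)

lemma op_Lm (a : H →L[ℂ] H) (v : HSp e) : (Lm e a v).op = a * v.op := op_toHS _ (v.isHS.mul_left a)

lemma norm_Lm_le (a : H →L[ℂ] H) (v : HSp e) : ‖Lm e a v‖ ≤ ‖a‖ * ‖v‖ := HSp.norm_left_le a v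

lemma HSp.norm_right_le (a : H →L[ℂ] H) (v : HSp e) :
    ‖toHS (v.op * a) (v.isHS.mul_right a)‖ ≤ ‖a‖ * ‖v‖ := by
  have : toHS (v.op * a) (v.isHS.mul_right a) = (Lm e (star a) v.J).J :=
    op_injective (by simp [op_toHS, op_J, op_Lm])
  rw [this, norm_J]
  exact (norm_Lm_le _ _).trans (by rw [norm_J, norm_star])

/-- right multiplication -/
def Rm (e : HilbertBasis ι ℂ H) : (H →L[ℂ] H) →L[ℝ] HSp e →L[ℝ] HSp e :=
  LinearMap.mkContinuous₂
    (LinearMap.mk₂ ℝ (fun a v => toHS (v.op * a) (v.isHS.mul_right a))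
      (fun a b v => HSp.op_injective (by simp [op_toHS, mul_add]))
      (fun c a v => HSp.op_injective (by simp [op_toHS]))
      (fun a v w => HSp.op_injective (by simp [op_toHS, add_mul]))
      (fun c a v => HSp.op_injective (by simp [op_toHS]))) 1
    (fun a v => by rw [one_mul]; exact HSp.norm_right_le a v)

lemma op_Rm (a : H →L[ℂ] H) (v : HSp e) : (Rm e a v).op = v.op * a := op_toHS _ (v.isHS.mul_right a)

lemma norm_Rm_le (a : H →L[ℂ] H) (v : HSp e) : ‖Rm e a v‖ ≤ ‖a‖ * ‖v‖ := HSp.norm_right_le a v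

lemma Rm_eq (a : H →L[ℂ] H) (v : HSp e) : Rm e a v = (Lm e (star a) v.J).J :=
    HSp.op_injective (by simp [op_Rm, HSp.op_J, op_Lm])

lemma inner_Lm (a : H →L[ℂ] H) (v w : HSp e) : ⟪Lm e a v, w⟫_ℝ = ⟪v, Lm e (star a) w⟫_ℝ := by
  rw [HSp.inner_eq, HSp.inner_eq]
  simp only [← HSp.op_basis, op_Lm, ContinuousLinearMap.mul_apply, ContinuousLinearMap.star_eq_adjoint,
    ContinuousLinearMap.adjoint_inner_right]

lemma inner_Rm (a : H →L[ℂ] H) (v w : HSp e) : ⟪Rm e a v, w⟫_ℝ = ⟪v, Rm e (star a) w⟫_ℝ := by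
  rw [Rm_eq, Rm_eq, ← HSp.inner_J, HSp.J_J, inner_Lm, ← HSp.inner_J v, HSp.J_J]

end HSpace2
end Part2

section Part3
open scoped Nat

lemma hs_congr {α : Type*} [AddCommMonoid α] [TopologicalSpace α] {f g : ℕ → α} {a : α}
    (h : ∀ n, f n = g n) (hg : HasSum g a) : HasSum f a := by
  rw [funext h]; exact hg

section PowerSeries
variable {𝔸 : Type*} [NormedRing 𝔸] [NormedAlgebra ℝ 𝔸] [CompleteSpace 𝔸]

/-- power series in a Banach algebra -/
def pw (c : ℕ → ℝ) (A : 𝔸) : 𝔸 := ∑' n, c n • A ^ n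

/-- coefficients of exponential type -/
def ExpBd (c : ℕ → ℝ) : Prop := ∀ n, |c n| ≤ 2 * ((n)! : ℝ)⁻¹

lemma pw_summable_norm {c : ℕ → ℝ} (hc : ExpBd c) (A : 𝔸) : Summable fun n => ‖c n • A ^ n‖ := by
  refine Summable.of_nonneg_of_le (fun _ => norm_nonneg _) (fun n => ?_)
    ((NormedSpace.norm_expSeries_summable' (𝕂 := ℝ) A).mul_left 2)
  rw [norm_smul, norm_smul, ← mul_assoc]
  gcongr
  have := hc n
  rwa [Real.norm_eq_abs, Real.norm_of_nonneg (by positivity)]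

lemma pw_hasSum {c : ℕ → ℝ} (hc : ExpBd c) (A : 𝔸) : HasSum (fun n => c n • A ^ n) (pw c A) :=
  (pw_summable_norm hc A).of_norm.hasSum

lemma norm_pow_succ_sub_le {A B : 𝔸} {R : ℝ} (hA : ‖A‖ ≤ R) (hB : ‖B‖ ≤ R) (n : ℕ) :
    ‖A ^ (n + 1) - B ^ (n + 1)‖ ≤ (n + 1) * R ^ n * ‖A - B‖ := by
  have hR : 0 ≤ R := (norm_nonneg _).trans hA
  induction n with
  | zero => simp
  | succ n ih =>
    have : A ^ (n + 1 + 1) - B ^ (n + 1 + 1) = A ^ (n + 1) * (A - B) + (A ^ (n + 1) - B ^ (n + 1)) * B := by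
      rw [mul_sub, sub_mul, ← pow_succ, ← pow_succ]; abel
    rw [this]
    have h1 : ‖A ^ (n + 1)‖ ≤ R ^ (n + 1) :=
      (norm_pow_le' _ (Nat.succ_pos _)).trans (pow_le_pow_left₀ (norm_nonneg _) hA _)
    calc _ ≤ ‖A ^ (n + 1)‖ * ‖A - B‖ + ‖A ^ (n + 1) - B ^ (n + 1)‖ * ‖B‖ :=
          (norm_add_le _ _).trans (add_le_add (norm_mul_le _ _) (norm_mul_le _ _))
      _ ≤ R ^ (n + 1) * ‖A - B‖ + ((n + 1) * R ^ n * ‖A - B‖) * R := by gcongr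
      _ = _ := by push_cast; ring

lemma pw_lipschitz {c : ℕ → ℝ} (hc : ExpBd c) {A B : 𝔸} {R : ℝ} (hA : ‖A‖ ≤ R) (hB : ‖B‖ ≤ R) :
    ‖pw c A - pw c B‖ ≤ 2 * Real.exp R * ‖A - B‖ := by
  have hR : 0 ≤ R := (norm_nonneg _).trans hA
  have h := (pw_hasSum hc A).sub (pw_hasSum hc B)
  rw [← hasSum_nat_add_iff' 1] at h
  simp only [Finset.range_one, Finset.sum_singleton, pow_zero, sub_self, sub_zero] at h
  have hs : HasSum (fun n : ℕ => 2 * ((n ! : ℝ)⁻¹ • R ^ n) * ‖A - B‖) (2 * Real.exp R * ‖A - B‖) := by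
    have := NormedSpace.exp_series_hasSum_exp' (𝕂 := ℝ) R
    rw [← Real.exp_eq_exp_ℝ] at this
    exact (this.mul_left 2).mul_right _
  rw [← h.tsum_eq]
  refine tsum_of_norm_bounded hs fun n => ?_
  rw [← smul_sub, norm_smul]
  have h1 := norm_pow_succ_sub_le hA hB n
  have h2 := hc (n + 1)
  calc ‖c (n + 1)‖ * ‖A ^ (n + 1) - B ^ (n + 1)‖
      ≤ (2 * ((n + 1)! : ℝ)⁻¹) * ((n + 1) * R ^ n * ‖A - B‖) := by
        gcongr
        exact h2
    _ = _ := by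
        rw [Nat.factorial_succ]; push_cast
        have : (n ! : ℝ) ≠ 0 := by positivity
        simp only [smul_eq_mul]
        field_simp

lemma pw_continuous {c : ℕ → ℝ} (hc : ExpBd c) : Continuous (pw c : 𝔸 → 𝔸) := by
  rw [continuous_iff_continuousAt]
  intro A
  have hev : ∀ᶠ B in nhds A, ‖pw c B - pw c A‖ ≤ 2 * Real.exp (‖A‖ + 1) * ‖B - A‖ := by
    have : ∀ᶠ B in nhds A, ‖B‖ < ‖A‖ + 1 :=
      continuous_norm.continuousAt.eventually_lt continuousAt_const (by simp)
    filter_upwards [this] with B hB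
    exact pw_lipschitz hc hB.le (by simp)
  rw [ContinuousAt, tendsto_iff_norm_sub_tendsto_zero]
  refine squeeze_zero' (Filter.Eventually.of_forall fun _ => norm_nonneg _) hev ?_
  have : Continuous fun B : 𝔸 => 2 * Real.exp (‖A‖ + 1) * ‖B - A‖ := by fun_prop
  simpa using this.tendsto A

/-- coefficients of `sinh z / z` -/
def scC (n : ℕ) : ℝ := (1 + (-1) ^ n) / 2 * ((n + 1)! : ℝ)⁻¹
/-- coefficients of `2 cosh z` -/
def chC (n : ℕ) : ℝ := (1 + (-1) ^ n) * ((n)! : ℝ)⁻¹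

lemma scC_bd : ExpBd scC := by
  intro n
  have h2 : ((n + 1)! : ℝ)⁻¹ ≤ (n ! : ℝ)⁻¹ := by
    gcongr; omega
  have h3 : (0:ℝ) < ((n + 1)! : ℝ)⁻¹ := by positivity
  unfold scC
  rcases neg_one_pow_eq_or ℝ n with h | h <;> rw [h] <;> norm_num
  · linarith

lemma chC_bd : ExpBd chC := by
  intro n
  have h3 : (0:ℝ) < ((n)! : ℝ)⁻¹ := by positivity
  unfold chC
  rcases neg_one_pow_eq_or ℝ n with h | h <;> rw [h] <;> norm_num

lemma scC_odd {n : ℕ} (hn : Odd n) : scC n = 0 := by simp [scC, hn.neg_one_pow]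
lemma chC_odd {n : ℕ} (hn : Odd n) : chC n = 0 := by simp [chC, hn.neg_one_pow]
lemma scC_nonneg (n : ℕ) : 0 ≤ scC n := by
  have h3 : (0:ℝ) < ((n + 1)! : ℝ)⁻¹ := by positivity
  unfold scC
  rcases neg_one_pow_eq_or ℝ n with h | h <;> rw [h] <;> norm_num
lemma scC_zero : scC 0 = 1 := by simp [scC]
lemma chC_zero : chC 0 = 2 := by simp [chC]; norm_num

lemma pw_ch (A : 𝔸) : pw chC A = NormedSpace.exp A + NormedSpace.exp (-A) := by
  have h := (NormedSpace.exp_series_hasSum_exp' (𝕂 := ℝ) A).add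
    (NormedSpace.exp_series_hasSum_exp' (𝕂 := ℝ) (-A))
  refine (pw_hasSum chC_bd A).unique ?_
  convert h using 2 with n
  rw [neg_pow A, chC]
  rcases neg_one_pow_eq_or ℝ n with h | h
  · have h' : (-1 : 𝔸) ^ n = 1 := by
      have := congrArg (algebraMap ℝ 𝔸) h; simpa using this
    rw [h, h', one_mul, ← add_smul]; ring_nf
  · have h' : (-1 : 𝔸) ^ n = -1 := by
      have := congrArg (algebraMap ℝ 𝔸) h; simpa using this
    rw [h, h', neg_one_mul]; simp

lemma pw_sc_mul (A : 𝔸) :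
    (2 : ℝ) • (pw scC A * A) = NormedSpace.exp A - NormedSpace.exp (-A) := by
  have h := (NormedSpace.exp_series_hasSum_exp' (𝕂 := ℝ) A).sub
    (NormedSpace.exp_series_hasSum_exp' (𝕂 := ℝ) (-A))
  rw [← hasSum_nat_add_iff' 1] at h
  simp only [Finset.range_one, Finset.sum_singleton, pow_zero, sub_self, sub_zero] at h
  refine (((pw_hasSum scC_bd A).mul_right A).const_smul (2:ℝ)).unique ?_
  refine hs_congr (fun n => ?_) h
  rw [neg_pow A, scC, smul_mul_assoc, ← pow_succ, smul_smul, pow_succ (-1 : 𝔸)]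
  rcases neg_one_pow_eq_or ℝ n with h | h
  · have h' : (-1 : 𝔸) ^ n = 1 := by
      have := congrArg (algebraMap ℝ 𝔸) h; simpa using this
    rw [h, h', one_mul, neg_one_mul, smul_neg, sub_neg_eq_add, ← add_smul]; ring_nf
  · have h' : (-1 : 𝔸) ^ n = -1 := by
      have := congrArg (algebraMap ℝ 𝔸) h; simpa using this
    rw [h, h']; simp

end PowerSeries

section PowerOps
variable {V : Type*} [NormedAddCommGroup V] [NormedSpace ℝ V] [CompleteSpace V]
variable {W : Type*} [NormedAddCommGroup W] [NormedSpace ℝ W] [CompleteSpace W]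

lemma pw_apply_hasSum {c : ℕ → ℝ} (hc : ExpBd c) (T : V →L[ℝ] V) (v : V) :
    HasSum (fun n => c n • (T ^ n) v) (pw c T v) :=
  (pw_hasSum hc T).mapL (ContinuousLinearMap.apply ℝ V v)

lemma pw_intertwine {c : ℕ → ℝ} (hc : ExpBd c) (T : V →L[ℝ] V) (S : W →L[ℝ] W) (f : V →L[ℝ] W)
    (h : ∀ v, f (T v) = S (f v)) (v : V) : f (pw c T v) = pw c S (f v) := by
  have hn : ∀ n, ∀ v, f ((T ^ n) v) = (S ^ n) (f v) := by
    intro n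
    induction n with
    | zero => simp
    | succ n ih => intro v; rw [pow_succ, pow_succ]; simp only [ContinuousLinearMap.mul_apply, ih, h]
  refine ((pw_apply_hasSum hc T v).mapL f).unique ?_
  simpa only [hn, map_smul] using pw_apply_hasSum hc S (f v)

lemma pw_of_apply_eq_zero {c : ℕ → ℝ} (hc : ExpBd c) (T : V →L[ℝ] V) (v : V) (h : T v = 0) :
    pw c T v = c 0 • v := by
  refine (pw_apply_hasSum hc T v).unique ?_
  convert hasSum_single 0 ?_ using 1
  · simp
  · intro n hn
    obtain ⟨m, rfl⟩ := Nat.exists_eq_succ_of_ne_zero hn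
    rw [pow_succ]; simp [h]

lemma pw_mem {c : ℕ → ℝ} (hc : ExpBd c) (hodd : ∀ n, Odd n → c n = 0) (T : V →L[ℝ] V)
    (K : Submodule ℝ V) (hK : IsClosed (K : Set V)) (hT : ∀ v ∈ K, T (T v) ∈ K) {v : V} (hv : v ∈ K) :
    pw c T v ∈ K := by
  have hn : ∀ n, ∀ v ∈ K, (T ^ (2 * n)) v ∈ K := by
    intro n
    induction n with
    | zero => simp
    | succ n ih =>
      intro v hv
      rw [mul_add, pow_add]
      exact ih _ (by simpa [pow_two] using hT v hv)
  refine hK.mem_of_tendsto (pw_apply_hasSum hc T v) (Filter.Eventually.of_forall fun s => ?_)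
  refine K.sum_mem fun n _ => ?_
  rcases Nat.even_or_odd' n with ⟨k, rfl | rfl⟩
  · exact K.smul_mem _ (hn k v hv)
  · rw [hodd _ ⟨k, rfl⟩]; simp

end PowerOps

section PowerInner
variable {V : Type*} [NormedAddCommGroup V] [InnerProductSpace ℝ V] [CompleteSpace V]

lemma pw_symm {c : ℕ → ℝ} (hc : ExpBd c) (T : V →L[ℝ] V) (hT : ∀ v w, ⟪T v, w⟫_ℝ = ⟪v, T w⟫_ℝ) (v w : V) :
    ⟪pw c T v, w⟫_ℝ = ⟪v, pw c T w⟫_ℝ := by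
  have hn : ∀ n, ∀ v w, ⟪(T ^ n) v, w⟫_ℝ = ⟪v, (T ^ n) w⟫_ℝ := by
    intro n
    induction n with
    | zero => simp
    | succ n ih =>
      intro v w
      nth_rewrite 1 [pow_succ]; rw [pow_succ']; simp only [ContinuousLinearMap.mul_apply, ih, hT]
  have h1 := (pw_apply_hasSum hc T v).mapL (innerSL ℝ w)
  have h2 := (pw_apply_hasSum hc T w).mapL (innerSL ℝ v)
  rw [real_inner_comm]
  refine h1.unique ?_
  refine hs_congr (fun n => ?_) h2
  simp only [innerSL_apply_apply, inner_smul_right]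
  rw [← hn, real_inner_comm]

lemma sc_coercive (T : V →L[ℝ] V) (hT : ∀ v w, ⟪T v, w⟫_ℝ = ⟪v, T w⟫_ℝ) (v : V) :
    ‖v‖ ^ 2 ≤ ⟪v, pw scC T v⟫_ℝ := by
  have hn : ∀ n, ∀ v w, ⟪(T ^ n) v, w⟫_ℝ = ⟪v, (T ^ n) w⟫_ℝ := by
    intro n
    induction n with
    | zero => simp
    | succ n ih =>
      intro v w
      nth_rewrite 1 [pow_succ]; rw [pow_succ']; simp only [ContinuousLinearMap.mul_apply, ih, hT]
  have h2 := (pw_apply_hasSum scC_bd T v).mapL (innerSL ℝ v)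
  have := le_hasSum h2 0 (fun n _ => by
    simp only [innerSL_apply_apply, inner_smul_right]
    rcases Nat.even_or_odd' n with ⟨k, rfl | rfl⟩
    · refine mul_nonneg (scC_nonneg _) ?_
      rw [two_mul, pow_add, ContinuousLinearMap.mul_apply, ← hn]
      exact real_inner_self_nonneg
    · rw [scC_odd ⟨k, rfl⟩]; simp)
  simpa [scC_zero, real_inner_self_eq_norm_sq] using this

lemma sc_lower (T : V →L[ℝ] V) (hT : ∀ v w, ⟪T v, w⟫_ℝ = ⟪v, T w⟫_ℝ) (v : V) :
    ‖v‖ ≤ ‖pw scC T v‖ := by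
  have h1 := sc_coercive T hT v
  have h2 := real_inner_le_norm v (pw scC T v)
  rcases (norm_nonneg v).eq_or_lt with h | h
  · rw [← h]; positivity
  · nlinarith

lemma sc_surj (T : V →L[ℝ] V) (hT : ∀ v w, ⟪T v, w⟫_ℝ = ⟪v, T w⟫_ℝ)
    (K : Submodule ℝ V) (hK : IsClosed (K : Set V)) (hTK : ∀ v ∈ K, T (T v) ∈ K) {w : V} (hw : w ∈ K) :
    ∃ z ∈ K, pw scC T z = w := by
  have : CompleteSpace K := hK.completeSpace_coe
  let S : K →L[ℝ] K := ((pw scC T).comp K.subtypeL).codRestrict K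
    (fun v => pw_mem scC_bd (fun n hn => scC_odd hn) T K hK hTK v.2)
  have hS : IsUnit S := by
    refine ContinuousLinearMap.isUnit_of_forall_le_norm_inner_map S (c := 1) one_pos fun x => ?_
    have := sc_coercive T hT (x : V)
    have h3 : ⟪S x, x⟫_ℝ = ⟪(x : V), pw scC T (x : V)⟫_ℝ := by rw [real_inner_comm]; rfl
    rw [h3]
    refine le_trans ?_ (le_abs_self _)
    simpa using this
  obtain ⟨u, hu⟩ := hS
  refine ⟨((↑u⁻¹ : K →L[ℝ] K) ⟨w, hw⟩ : K), Subtype.property _, ?_⟩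
  have : S ((↑u⁻¹ : K →L[ℝ] K) ⟨w, hw⟩) = ⟨w, hw⟩ := by
    rw [← hu, ← ContinuousLinearMap.mul_apply, u.mul_inv]; rfl
  exact congrArg Subtype.val this

end PowerInner
end Part3

section Part4
open scoped Nat
section AlgExp
variable {𝔸 : Type*} [NormedRing 𝔸] [NormedAlgebra ℝ 𝔸] [CompleteSpace 𝔸]

lemma pw_exp (A : 𝔸) : pw (fun n => (n ! : ℝ)⁻¹) A = NormedSpace.exp A :=
  (NormedSpace.exp_series_hasSum_exp' (𝕂 := ℝ) A).tsum_eq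

lemma expC_bd : ExpBd (fun n => (n ! : ℝ)⁻¹) := by
  intro n
  have h3 : (0:ℝ) < ((n)! : ℝ)⁻¹ := by positivity
  show |((n)! : ℝ)⁻¹| ≤ _
  rw [abs_of_pos h3]; linarith

lemma exp_mulL (c x : 𝔸) : NormedSpace.exp (ContinuousLinearMap.mul ℝ 𝔸 c) x = NormedSpace.exp c * x := by
  have h := (NormedSpace.exp_series_hasSum_exp' (𝕂 := ℝ) (ContinuousLinearMap.mul ℝ 𝔸 c)).mapL
    (ContinuousLinearMap.apply ℝ 𝔸 x)
  refine h.unique (hs_congr (fun n => ?_)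
    ((NormedSpace.exp_series_hasSum_exp' (𝕂 := ℝ) c).mul_right x))
  have hn : ∀ n : ℕ, ∀ x, ((ContinuousLinearMap.mul ℝ 𝔸 c) ^ n) x = c ^ n * x := by
    intro n
    induction n with
    | zero => simp
    | succ n ih =>
      intro x
      rw [pow_succ, ContinuousLinearMap.mul_apply, ih, pow_succ, mul_assoc]; rfl
  rw [ContinuousLinearMap.apply_apply, smul_mul_assoc, ← hn]; rfl

lemma exp_mulR (c x : 𝔸) :
    NormedSpace.exp ((ContinuousLinearMap.mul ℝ 𝔸).flip c) x = x * NormedSpace.exp c := by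
  have h := (NormedSpace.exp_series_hasSum_exp' (𝕂 := ℝ) ((ContinuousLinearMap.mul ℝ 𝔸).flip c)).mapL
    (ContinuousLinearMap.apply ℝ 𝔸 x)
  refine h.unique (hs_congr (fun n => ?_)
    ((NormedSpace.exp_series_hasSum_exp' (𝕂 := ℝ) c).mul_left x))
  have hn : ∀ n : ℕ, ∀ x, (((ContinuousLinearMap.mul ℝ 𝔸).flip c) ^ n) x = x * c ^ n := by
    intro n
    induction n with
    | zero => simp
    | succ n ih =>
      intro x
      rw [pow_succ, ContinuousLinearMap.mul_apply, ih, pow_succ', ← mul_assoc]; rfl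
  rw [ContinuousLinearMap.apply_apply, mul_smul_comm, ← hn]; rfl

lemma exp_add_cm {x y : 𝔸} (h : Commute x y) :
    NormedSpace.exp (x + y) = NormedSpace.exp x * NormedSpace.exp y := by
  let _ : NormedAlgebra ℚ 𝔸 := NormedAlgebra.restrictScalars ℚ ℝ 𝔸
  exact NormedSpace.exp_add_of_commute h

lemma exp_cont : Continuous (NormedSpace.exp : 𝔸 → 𝔸) := by
  let _ : NormedAlgebra ℚ 𝔸 := NormedAlgebra.restrictScalars ℚ ℝ 𝔸
  exact NormedSpace.exp_continuous

/-- half of `x ↦ a x - x b` -/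
def TB (a b : 𝔸) : 𝔸 →L[ℝ] 𝔸 :=
  ContinuousLinearMap.mul ℝ 𝔸 ((1/2:ℝ) • a) + (ContinuousLinearMap.mul ℝ 𝔸).flip (-((1/2:ℝ) • b))

lemma TB_apply (a b x : 𝔸) : TB a b x = (1/2:ℝ) • (a * x - x * b) := by
  simp [TB, smul_sub, sub_eq_add_neg]

lemma exp_TB (a b x : 𝔸) :
    NormedSpace.exp (TB a b) x = NormedSpace.exp ((1/2:ℝ) • a) * x * NormedSpace.exp (-((1/2:ℝ) • b)) := by
  rw [TB, exp_add_cm, ContinuousLinearMap.mul_apply, exp_mulR, exp_mulL, mul_assoc]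
  ext x
  simp [mul_assoc]

lemma exp_neg_TB (a b x : 𝔸) :
    NormedSpace.exp (-TB a b) x = NormedSpace.exp (-((1/2:ℝ) • a)) * x * NormedSpace.exp (((1/2:ℝ) • b)) := by
  have : -TB a b = TB (-a) (-b) := by
    ext x; rw [ContinuousLinearMap.neg_apply, TB_apply, TB_apply]
    rw [← smul_neg]; congr 1; noncomm_ring
  rw [this, exp_TB]; simp

lemma exp_half_mul (a : 𝔸) : NormedSpace.exp ((1/2:ℝ) • a) * NormedSpace.exp ((1/2:ℝ) • a) = NormedSpace.exp a := by
  rw [← exp_add_cm (Commute.refl _), ← add_smul]; norm_num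

lemma exp_mul_neg (a : 𝔸) : NormedSpace.exp a * NormedSpace.exp (-a) = 1 := by
  rw [← exp_add_cm ((Commute.refl a).neg_right)]; simp

lemma exp_neg_mul (a : 𝔸) : NormedSpace.exp (-a) * NormedSpace.exp a = 1 := by
  rw [← exp_add_cm ((Commute.refl a).neg_left)]; simp

lemma exp_sub_exp (a b : 𝔸) : NormedSpace.exp a - NormedSpace.exp b =
    NormedSpace.exp ((1/2:ℝ) • a) * pw scC (TB a b) (a - b) * NormedSpace.exp ((1/2:ℝ) • b) := by
  have h := congrArg (fun S : 𝔸 →L[ℝ] 𝔸 => S 1) (pw_sc_mul (TB a b))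
  simp only [ContinuousLinearMap.smul_apply, ContinuousLinearMap.mul_apply, ContinuousLinearMap.sub_apply,
    exp_TB, exp_neg_TB, mul_one, one_mul] at h
  rw [TB_apply, mul_one, one_mul, map_smul, smul_smul] at h
  norm_num at h
  have h2 := exp_half_mul a
  have h3 := exp_half_mul b
  have h4 := exp_mul_neg ((1/2:ℝ) • a)
  have h5 := exp_neg_mul ((1/2:ℝ) • b)
  norm_num at h2 h3 h4 h5 ⊢
  rw [h, mul_sub, sub_mul, ← mul_assoc, ← mul_assoc, h2, h4, mul_assoc, h5, one_mul, h3, mul_one]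

end AlgExp

section HSExp
variable {e : HilbertBasis ι ℂ H}

/-- exponential -/
def ex (v : HSp e) : H →L[ℂ] H := NormedSpace.exp v.op
/-- exponential of half -/
def eh (v : HSp e) : H →L[ℂ] H := NormedSpace.exp ((1/2:ℝ) • v.op)
/-- exponential of minus half -/
def en (v : HSp e) : H →L[ℂ] H := NormedSpace.exp (-((1/2:ℝ) • v.op))

lemma ex_half (v : HSp e) : ex ((1/2:ℝ) • v) = eh v := by simp [ex, eh]
lemma ex_neg_half (v : HSp e) : ex (-(1/2:ℝ) • v) = en v := by simp [ex, en]
lemma ex_zero : ex (0 : HSp e) = 1 := by simp [ex]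
lemma eh_mul_eh (v : HSp e) : eh v * eh v = ex v := exp_half_mul _
lemma eh_mul_en (v : HSp e) : eh v * en v = 1 := exp_mul_neg _
lemma en_mul_eh (v : HSp e) : en v * eh v = 1 := exp_neg_mul _
lemma eh_neg (v : HSp e) : eh (-v) = en v := by simp [eh, en]
lemma en_neg (v : HSp e) : en (-v) = eh v := by simp [eh, en]
lemma en_mul_en (v : HSp e) : en v * en v = ex (-v) := by rw [← eh_neg, eh_mul_eh]
lemma ex_mul_neg (v : HSp e) : ex v * ex (-v) = 1 := by simpa [ex] using exp_mul_neg v.op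
lemma ex_neg_mul (v : HSp e) : ex (-v) * ex v = 1 := by simpa [ex] using exp_neg_mul v.op
lemma ex_add_smul (s t : ℝ) (v : HSp e) : ex ((s + t) • v) = ex (s • v) * ex (t • v) := by
  unfold ex
  rw [add_smul, map_add, exp_add_cm]
  simp only [map_smul]
  exact ((Commute.refl _).smul_left _).smul_right _

/-- self-adjointness -/
def Sa (v : HSp e) : Prop := v.J = v

lemma Sa.op {v : HSp e} (h : Sa v) : star v.op = v.op := by rw [← HSp.op_J, h]
lemma sa_of_op {v : HSp e} (h : star v.op = v.op) : Sa v := HSp.op_injective (by rw [HSp.op_J, h])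
lemma Sa.smul {v : HSp e} (h : Sa v) (c : ℝ) : Sa (c • v) := by unfold Sa at *; rw [HSp.J_smul, h]
lemma Sa.neg {v : HSp e} (h : Sa v) : Sa (-v) := by simpa using h.smul (-1)
lemma sa_zero : Sa (0 : HSp e) := sa_of_op (by simp)
lemma Sa.ex {v : HSp e} (h : Sa v) : star (ex v) = ex v := by
  unfold _root_.ex; rw [NormedSpace.star_exp, h.op]
lemma Sa.eh {v : HSp e} (h : Sa v) : star (eh v) = eh v := by rw [← ex_half]; exact (h.smul _).ex
lemma Sa.en {v : HSp e} (h : Sa v) : star (en v) = en v := by rw [← ex_neg_half]; exact (h.smul _).ex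

/-- half of `v ↦ a v - v b` on `HSp` -/
def Tt (a b : HSp e) : HSp e →L[ℝ] HSp e := (1/2:ℝ) • (Lm e a.op - Rm e b.op)

lemma op_Tt (a b v : HSp e) : (Tt a b v).op = TB a.op b.op v.op := by
  simp [Tt, TB_apply, op_Lm, op_Rm]

lemma Tt_symm {a b : HSp e} (ha : Sa a) (hb : Sa b) (v w : HSp e) : ⟪Tt a b v, w⟫_ℝ = ⟪v, Tt a b w⟫_ℝ := by
  simp only [Tt, ContinuousLinearMap.smul_apply, ContinuousLinearMap.sub_apply, inner_smul_left,
    inner_smul_right, inner_sub_left, inner_sub_right, inner_Lm, inner_Rm, ha.op, hb.op]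
  simp

/-- the operator `sinh T / T` -/
def Sc (a b : HSp e) : HSp e →L[ℝ] HSp e := pw scC (Tt a b)

lemma ex_sub_ex (a b : HSp e) : ex a - ex b = eh a * (Sc a b (a - b)).op * eh b := by
  unfold ex eh Sc
  rw [exp_sub_exp, pw_intertwine scC_bd (Tt a b) (TB a.op b.op) HSp.op (op_Tt a b), HSp.op.map_sub a b]

lemma Sc_lower {a b : HSp e} (ha : Sa a) (hb : Sa b) (v : HSp e) : ‖v‖ ≤ ‖Sc a b v‖ :=
  sc_lower _ (Tt_symm ha hb) v

/-- if `ex a - ex b = w` then `Sc a b (a-b) = en a * w * en b` -/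
lemma Sc_sub_eq {a b w : HSp e} (h : ex a - ex b = w.op) : Sc a b (a - b) = Lm e (en a) (Rm e (en b) w) := by
  apply HSp.op_injective
  simp only [op_Lm, op_Rm, ← h, ex_sub_ex]
  rw [show en a * ((eh a * (Sc a b (a - b)).op * eh b) * en b) =
    (en a * eh a) * (Sc a b (a - b)).op * (eh b * en b) by noncomm_ring, eh_mul_en, en_mul_eh]; simp

lemma ex_injective {a b : HSp e} (ha : Sa a) (hb : Sa b) (h : ex a = ex b) : a = b := by
  have h1 := Sc_sub_eq (a := a) (b := b) (w := 0) (by simp [h])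
  have h2 := Sc_lower ha hb (a - b)
  rw [h1] at h2
  simp only [map_zero, norm_zero, norm_le_zero_iff] at h2
  exact sub_eq_zero.1 h2

lemma Tt_continuous : Continuous (fun p : HSp e × HSp e => Tt p.1 p.2) := by
  unfold Tt; fun_prop

lemma Sc_continuous : Continuous (fun p : HSp e × HSp e => Sc p.1 p.2) :=
  (pw_continuous scC_bd).comp Tt_continuous

lemma ex_continuous : Continuous (ex : HSp e → (H →L[ℂ] H)) := by
  unfold ex
  exact exp_cont.comp HSp.op.continuous
lemma eh_continuous : Continuous (eh : HSp e → (H →L[ℂ] H)) := by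
  have : (eh : HSp e → (H →L[ℂ] H)) = fun v => ex ((1/2:ℝ) • v) := by ext1 v; rw [ex_half]
  rw [this]; exact ex_continuous.comp (continuous_const_smul _)

lemma ex_mul_op_comm (v : HSp e) : ex v * v.op = v.op * ex v :=
  ((Commute.refl v.op).exp_left).eq

lemma Tt_self (v : HSp e) : Tt v v v = 0 := HSp.op_injective (by rw [op_Tt, TB_apply]; simp)

lemma exp_Tt (a b v : HSp e) : (NormedSpace.exp (Tt a b) v).op = eh a * v.op * en b := by
  rw [← pw_exp, pw_intertwine expC_bd (Tt a b) (TB a.op b.op) HSp.op (op_Tt a b), pw_exp, exp_TB]; rfl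

lemma exp_neg_Tt (a b v : HSp e) : (NormedSpace.exp (-Tt a b) v).op = en a * v.op * eh b := by
  have : -Tt a b = Tt (-a) (-b) := by
    ext v; apply HSp.op_injective
    rw [ContinuousLinearMap.neg_apply, map_neg, op_Tt, op_Tt, TB_apply, TB_apply, ← smul_neg]
    simp only [map_neg]
    congr 1; noncomm_ring
  rw [this, exp_Tt, eh_neg, en_neg]

lemma Ch_op (a v : HSp e) : (pw chC (Tt a a) v).op = eh a * v.op * en a + en a * v.op * eh a := by
  rw [pw_ch, ContinuousLinearMap.add_apply, map_add, exp_Tt, exp_neg_Tt]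

/-- `GL₂`: invertible with `g - 1` Hilbert–Schmidt; `ex v` belongs to it -/
lemma ex_sub_one (v : HSp e) : IsHS e (ex v - 1) := by
  rw [← ex_zero (e := e), ex_sub_ex]
  exact ((HSp.isHS _).mul_left _).mul_right _

end HSExp
end Part4

section Part5
open Filter Topology
section Log
variable {e : HilbertBasis ι ℂ H}

lemma IsHS.add' {A B : H →L[ℂ] H} (hA : IsHS e A) (hB : IsHS e B) : IsHS e (A + B) := by
  obtain ⟨v, rfl⟩ := hA.exists_op
  obtain ⟨w, rfl⟩ := hB.exists_op
  rw [← map_add]; exact HSp.isHS _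

lemma MemGL2.mul {x y : H →L[ℂ] H} (hx : MemGL2 e x) (hy : MemGL2 e y) : MemGL2 e (x * y) := by
  refine ⟨hx.1.mul hy.1, ?_⟩
  rw [show x * y - 1 = (x - 1) * y + (y - 1) by noncomm_ring]
  exact (hx.2.mul_right _).add' hy.2

lemma MemGL2.star {x : H →L[ℂ] H} (hx : MemGL2 e x) : MemGL2 e (star x) := by
  refine ⟨hx.1.star, ?_⟩
  have := hx.2.star'
  simpa using this

lemma memGL2_ex (v : HSp e) : MemGL2 e (ex v) :=
  ⟨⟨⟨ex v, ex (-v), ex_mul_neg v, ex_neg_mul v⟩, rfl⟩, ex_sub_one v⟩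
lemma memGL2_eh (v : HSp e) : MemGL2 e (eh v) := by rw [← ex_half]; exact memGL2_ex _
lemma memGL2_en (v : HSp e) : MemGL2 e (en v) := by rw [← ex_neg_half]; exact memGL2_ex _
lemma memGL2_one : MemGL2 e (1 : H →L[ℂ] H) := by rw [← ex_zero (e := e)]; exact memGL2_ex _

lemma exists_log {x : H →L[ℂ] H} (hx : MemGL2 e x) : ∃ v : HSp e, Sa v ∧ ex v = star x * x := by
  have hp : MemGL2 e (star x * x) := hx.star.mul hx
  set p := star x * x with hpdef
  have hsa : IsSelfAdjoint p := IsSelfAdjoint.star_mul_self x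
  have hpos : IsStrictlyPositive p := by
    rw [IsStrictlyPositive]
    exact ⟨star_mul_self_nonneg x, hp.1⟩
  have h1 : NormedSpace.exp (CFC.log p) = p := CFC.exp_log p hpos
  have h2 : star (CFC.log p) = CFC.log p := (IsSelfAdjoint.log : IsSelfAdjoint (CFC.log p))
  have hsp : ∀ t ∈ spectrum ℝ p, t ∈ Set.Ioi (0:ℝ) := fun t ht => hpos.spectrum_pos ht
  have hcont : ContinuousOn (dslope Real.log 1) (spectrum ℝ p) := by
    refine ContinuousOn.mono ?_ hsp
    rw [continuousOn_dslope (Ioi_mem_nhds one_pos)]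
    exact ⟨Real.continuousOn_log.mono (fun t ht => ne_of_gt ht), Real.differentiableAt_log one_ne_zero⟩
  have h3 : CFC.log p = (p - 1) * cfc (dslope Real.log 1) p := by
    have : Real.log = fun t => (t - 1) * dslope Real.log 1 t := by
      ext t
      have := sub_smul_dslope Real.log 1 t
      rw [smul_eq_mul] at this
      rw [this]; simp
    rw [CFC.log]
    conv_lhs => rw [this]
    rw [cfc_mul (fun t : ℝ => t - 1) (dslope Real.log 1) p (by fun_prop) hcont, cfc_sub (fun t : ℝ => t) (fun _ => 1) p (by fun_prop) (by fun_prop)]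
    rw [cfc_id' ℝ p, cfc_const_one ℝ p]
  have h4 : IsHS e (CFC.log p) := by rw [h3]; exact hp.2.mul_right _
  obtain ⟨v, hv⟩ := h4.exists_op
  exact ⟨v, sa_of_op (by rw [hv, h2]), by rw [ex, hv, h1]⟩

open Classical in
/-- the logarithm as an element of `HSp` -/
def lg (e : HilbertBasis ι ℂ H) (q : H →L[ℂ] H) : HSp e :=
  if h : ∃ v : HSp e, Sa v ∧ ex v = q then Classical.choose h else 0

lemma lg_sa (q : H →L[ℂ] H) : Sa (lg e q) := by
  unfold lg
  split_ifs with h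
  · exact (Classical.choose_spec h).1
  · exact sa_zero

lemma lg_spec {q : H →L[ℂ] H} (h : ∃ v : HSp e, Sa v ∧ ex v = q) : ex (lg e q) = q := by
  unfold lg
  rw [dif_pos h]; exact (Classical.choose_spec h).2

lemma lg_ex {v : HSp e} (h : Sa v) : lg e (ex v) = v :=
  ex_injective (lg_sa _) h (lg_spec ⟨v, h, rfl⟩)

/-- action of `GL₂` in logarithmic coordinates -/
def act (g : H →L[ℂ] H) (a : HSp e) : HSp e := lg e (g * ex a * star g)

lemma act_sa (g : H →L[ℂ] H) (a : HSp e) : Sa (act g a) := lg_sa _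

lemma ex_act {g : H →L[ℂ] H} (hg : MemGL2 e g) {a : HSp e} (ha : Sa a) :
    ex (act g a) = g * ex a * star g := by
  apply lg_spec
  obtain ⟨v, hv, h⟩ := exists_log ((memGL2_eh a).mul hg.star)
  refine ⟨v, hv, ?_⟩
  rw [h, star_mul, star_star, ha.eh, ← eh_mul_eh]; noncomm_ring

lemma act_unique {g : H →L[ℂ] H} {a b : HSp e} (hb : Sa b)
    (h : ex b = g * ex a * star g) : act g a = b := by
  unfold act; rw [← h, lg_ex hb]

lemma act_one {a : HSp e} (ha : Sa a) : act 1 a = a := act_unique ha (by simp)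

lemma act_mul {g h : H →L[ℂ] H} (hg : MemGL2 e g) (hh : MemGL2 e h) {a : HSp e} (ha : Sa a) :
    act g (act h a) = act (g * h) a := by
  symm
  apply act_unique (act_sa _ _)
  rw [ex_act hg (act_sa _ _), ex_act hh ha, star_mul]; noncomm_ring

lemma norm_Lm_unitary {u : H →L[ℂ] H} (h : star u * u = 1) (v : HSp e) : ‖Lm e u v‖ = ‖v‖ := by
  have : ‖Lm e u v‖ ^ 2 = ‖v‖ ^ 2 := by
    rw [← real_inner_self_eq_norm_sq, ← real_inner_self_eq_norm_sq, inner_Lm]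
    congr 1
    apply HSp.op_injective
    rw [op_Lm, op_Lm, ← mul_assoc, h, one_mul]
  nlinarith [norm_nonneg (Lm e u v), norm_nonneg v, sq_nonneg (‖Lm e u v‖ - ‖v‖),
    (sq_eq_sq₀ (norm_nonneg (Lm e u v)) (norm_nonneg v)).1 this]

lemma norm_Rm_unitary {u : H →L[ℂ] H} (h : u * star u = 1) (v : HSp e) : ‖Rm e u v‖ = ‖v‖ := by
  rw [Rm_eq, HSp.norm_J, norm_Lm_unitary (by simpa using h), HSp.norm_J]

lemma ex_conj {u : H →L[ℂ] H} (h : star u * u = 1) (h' : u * star u = 1) (v : HSp e) :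
    ex (Lm e u (Rm e (star u) v)) = u * ex v * star u := by
  unfold ex
  rw [op_Lm, op_Rm, ← mul_assoc]
  let _ : NormedAlgebra ℚ (H →L[ℂ] H) := NormedAlgebra.restrictScalars ℚ ℝ _
  exact NormedSpace.exp_units_conj (⟨u, star u, h', h⟩ : (H →L[ℂ] H)ˣ) v.op

lemma conj_sa {u : H →L[ℂ] H} {v : HSp e} (hv : Sa v) : Sa (Lm e u (Rm e (star u) v)) :=
  sa_of_op (by simp [op_Lm, op_Rm, hv.op, mul_assoc])

lemma norm_act_unitary {u : H →L[ℂ] H} (h : star u * u = 1) (h' : u * star u = 1) {v : HSp e} (hv : Sa v) :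
    ‖act u v‖ = ‖v‖ := by
  rw [act_unique (conj_sa hv) (ex_conj h h' v), norm_Lm_unitary h, norm_Rm_unitary (by simpa using h)]

/-- distance in logarithmic coordinates -/
def dd (a b : HSp e) : ℝ := ‖act (en a) b‖

/-- a `GL₂` element inducing a given transport is unitary after normalisation -/
lemma unitary_of {g : H →L[ℂ] H} (hg : MemGL2 e g) {a b : HSp e} (ha : Sa a) (hb : Sa b)
    (h : ex b = g * ex a * star g) :
    star (en b * g * eh a) * (en b * g * eh a) = 1 ∧ (en b * g * eh a) * star (en b * g * eh a) = 1 := by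
  have h2 : (en b * g * eh a) * star (en b * g * eh a) = 1 := by
    rw [star_mul, star_mul, ha.eh, hb.en, show en b * g * eh a * (eh a * (star g * en b)) =
      en b * (g * (eh a * eh a) * star g) * en b by noncomm_ring, eh_mul_eh, ← h, ← eh_mul_eh,
      show en b * (eh b * eh b) * en b = (en b * eh b) * (eh b * en b) by noncomm_ring, eh_mul_en, en_mul_eh, one_mul]
  refine ⟨?_, h2⟩
  have hu : IsUnit (en b * g * eh a) := (((memGL2_en b).mul hg).mul (memGL2_eh a)).1
  obtain ⟨u, hu⟩ := hu
  rw [← hu] at h2 ⊢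
  have : star (u : H →L[ℂ] H) = ((u⁻¹ : (H →L[ℂ] H)ˣ) : H →L[ℂ] H) := by
    calc star (u : H →L[ℂ] H) = (u⁻¹ : (H →L[ℂ] H)ˣ) * (u * star (u : H →L[ℂ] H)) := by simp
      _ = _ := by rw [h2, mul_one]
  rw [this]; simp

lemma dd_act {g : H →L[ℂ] H} (hg : MemGL2 e g) {a b : HSp e} (ha : Sa a) (hb : Sa b) :
    dd (act g a) (act g b) = dd a b := by
  unfold dd
  have hu := unitary_of hg ha (act_sa g a) (ex_act hg ha)
  set u := en (act g a) * g * eh a with hudef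
  have : act (en (act g a)) (act g b) = act u (act (en a) b) := by
    rw [act_mul (memGL2_en _) hg hb, act_mul (((memGL2_en _).mul hg).mul (memGL2_eh a)) (memGL2_en _) hb,
      mul_assoc _ (eh a), eh_mul_en, mul_one]
  rw [this, norm_act_unitary hu.1 hu.2 (act_sa _ _)]

lemma en_zero : en (0 : HSp e) = 1 := by simp [en]

lemma dd_zero_left {b : HSp e} (hb : Sa b) : dd 0 b = ‖b‖ := by
  unfold dd; rw [en_zero, act_one hb]

lemma dd_zero_right {a : HSp e} (ha : Sa a) : dd a 0 = ‖a‖ := by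
  unfold dd
  rw [act_unique (b := -a) ha.neg, norm_neg]
  rw [ex_zero, mul_one, ha.en, en_mul_en]

lemma act_en_self {a : HSp e} (ha : Sa a) : act (en a) a = 0 :=
  act_unique sa_zero (by
    rw [ex_zero, ha.en, ← eh_mul_eh,
      show en a * (eh a * eh a) * en a = (en a * eh a) * (eh a * en a) by noncomm_ring, eh_mul_en, en_mul_eh, one_mul])

lemma dd_self {a : HSp e} (ha : Sa a) : dd a a = 0 := by unfold dd; rw [act_en_self ha, norm_zero]

lemma dd_comm {a b : HSp e} (ha : Sa a) (hb : Sa b) : dd a b = dd b a := by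
  rw [← dd_act (memGL2_en a) hb ha, act_en_self ha, dd_zero_right (act_sa _ _)]; rfl

lemma dd_nonneg (a b : HSp e) : 0 ≤ dd a b := norm_nonneg _

end Log
end Part5

section Part6
open Filter Topology
section Conv
variable {e : HilbertBasis ι ℂ H} {α : Type*} {l : Filter α}

/-- convergence in Hilbert–Schmidt distance -/
def HTend (e : HilbertBasis ι ℂ H) (l : Filter α) (f : α → H →L[ℂ] H) (a : H →L[ℂ] H) : Prop :=
  ∃ v : α → HSp e, (∀ n, f n - a = (v n).op) ∧ Tendsto v l (𝓝 0)

lemma HTend.tendsto {f : α → H →L[ℂ] H} {a : H →L[ℂ] H} (h : HTend e l f a) : Tendsto f l (𝓝 a) := by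
  obtain ⟨v, hv, ht⟩ := h
  have h2 : Tendsto (fun n => (v n).op + a) l (𝓝 ((0 : HSp e).op + a)) :=
    ((HSp.op.continuous.tendsto _).comp ht).add_const a
  simp only [← hv, map_zero, zero_add, sub_add_cancel] at h2
  exact h2

lemma HTend.const (a : H →L[ℂ] H) : HTend e l (fun _ => a) a :=
  ⟨fun _ => 0, by simp, tendsto_const_nhds⟩

lemma tendsto_clm {F : α → HSp e →L[ℝ] HSp e} {T : HSp e →L[ℝ] HSp e} (h : Tendsto F l (𝓝 T))
    {v : α → HSp e} {w : HSp e} (hv : Tendsto v l (𝓝 w)) : Tendsto (fun n => F n (v n)) l (𝓝 (T w)) :=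
  ((isBoundedBilinearMap_apply (𝕜 := ℝ) (E := HSp e) (F := HSp e)).continuous.tendsto (T, w)).comp
    (h.prodMk_nhds hv)

lemma tendsto_Sc {f g : α → HSp e} {a b : HSp e} (h : Tendsto f l (𝓝 a)) (h' : Tendsto g l (𝓝 b))
    {v : α → HSp e} {w : HSp e} (hv : Tendsto v l (𝓝 w)) : Tendsto (fun n => Sc (f n) (g n) (v n)) l (𝓝 (Sc a b w)) :=
  tendsto_clm ((Sc_continuous.tendsto (a, b)).comp (h.prodMk_nhds h')) hv

lemma tendsto_Lm {f : α → H →L[ℂ] H} {a : H →L[ℂ] H} (h : Tendsto f l (𝓝 a)) {v : α → HSp e} {w : HSp e}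
    (hv : Tendsto v l (𝓝 w)) : Tendsto (fun n => Lm e (f n) (v n)) l (𝓝 (Lm e a w)) :=
  tendsto_clm (((Lm e).continuous.tendsto a).comp h) hv
lemma tendsto_Rm {f : α → H →L[ℂ] H} {a : H →L[ℂ] H} (h : Tendsto f l (𝓝 a)) {v : α → HSp e} {w : HSp e}
    (hv : Tendsto v l (𝓝 w)) : Tendsto (fun n => Rm e (f n) (v n)) l (𝓝 (Rm e a w)) :=
  tendsto_clm (((Rm e).continuous.tendsto a).comp h) hv

lemma HTend.mul {f g : α → H →L[ℂ] H} {a b : H →L[ℂ] H} (h : HTend e l f a) (h' : HTend e l g b) :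
    HTend e l (fun n => f n * g n) (a * b) := by
  have hg := h'.tendsto
  obtain ⟨v, hv, ht⟩ := h
  obtain ⟨w, hw, ht'⟩ := h'
  refine ⟨fun n => Rm e (g n) (v n) + Lm e a (w n), fun n => ?_, ?_⟩
  · rw [map_add, op_Rm, op_Lm, ← hv, ← hw]; noncomm_ring
  · have := (tendsto_Rm hg ht).add (tendsto_Lm (tendsto_const_nhds (x := a)) ht')
    simpa using this

lemma HSp.J_continuous : Continuous (HSp.J : HSp e → HSp e) := by
  rw [continuous_iff_continuousAt]
  intro v
  unfold ContinuousAt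
  rw [tendsto_iff_norm_sub_tendsto_zero]
  simp only [← HSp.J_sub, HSp.norm_J]
  rw [← tendsto_iff_norm_sub_tendsto_zero]
  exact tendsto_id

lemma HTend.star {f : α → H →L[ℂ] H} {a : H →L[ℂ] H} (h : HTend e l f a) :
    HTend e l (fun n => star (f n)) (star a) := by
  obtain ⟨v, hv, ht⟩ := h
  refine ⟨fun n => (v n).J, fun n => ?_, ?_⟩
  · rw [HSp.op_J, ← hv, star_sub]
  · have h2 := (HSp.J_continuous.tendsto _).comp ht
    rwa [show (0 : HSp e).J = 0 from sa_zero] at h2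

lemma en_continuous : Continuous (en : HSp e → (H →L[ℂ] H)) := by
  have : (en : HSp e → (H →L[ℂ] H)) = fun v => ex (-(1/2:ℝ) • v) := by ext1 v; rw [ex_neg_half]
  rw [this]; exact ex_continuous.comp (continuous_const_smul _)

/-- `ex` is continuous in Hilbert–Schmidt distance -/
lemma htend_ex {f : α → HSp e} {a : HSp e} (h : Tendsto f l (𝓝 a)) : HTend e l (fun n => ex (f n)) (ex a) := by
  refine ⟨fun n => Lm e (eh (f n)) (Rm e (eh a) (Sc (f n) a (f n - a))), fun n => ?_, ?_⟩
  · rw [ex_sub_ex, op_Lm, op_Rm, mul_assoc]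
  · have h1 : Tendsto (fun n => Sc (f n) a (f n - a)) l (𝓝 (Sc a a (a - a))) :=
      tendsto_Sc h tendsto_const_nhds (h.sub tendsto_const_nhds)
    have h2 := tendsto_Lm ((eh_continuous.tendsto a).comp h) (tendsto_Rm (tendsto_const_nhds (x := eh a)) h1)
    simpa using h2

lemma norm_en_sq {a : HSp e} (ha : Sa a) : ‖en a‖ ^ 2 = ‖ex (-a)‖ := by
  rw [← en_mul_en, sq]
  conv_rhs => rw [← ha.en]
  conv_rhs => rw [ha.en]; arg 1; arg 1; rw [← ha.en]
  rw [CStarRing.norm_star_mul_self]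

lemma ex_neg_eq_inverse (a : HSp e) : ex (-a) = Ring.inverse (ex a) := by
  let u : (H →L[ℂ] H)ˣ := ⟨ex a, ex (-a), ex_mul_neg a, ex_neg_mul a⟩
  exact (Ring.inverse_unit u).symm

/-- `log` is continuous in Hilbert–Schmidt distance -/
lemma tendsto_of_htend_ex {f : α → HSp e} {a : HSp e} (hf : ∀ n, Sa (f n)) (ha : Sa a)
    (h : HTend e l (fun n => ex (f n)) (ex a)) : Tendsto f l (𝓝 a) := by
  have h0 := h.tendsto
  obtain ⟨w, hw, ht⟩ := h
  have h1 : Tendsto (fun n => ex (-(f n))) l (𝓝 (ex (-a))) := by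
    simp only [ex_neg_eq_inverse]
    let u : (H →L[ℂ] H)ˣ := ⟨ex a, ex (-a), ex_mul_neg a, ex_neg_mul a⟩
    exact (NormedRing.inverse_continuousAt u).tendsto.comp h0
  have h2 : Tendsto (fun n => ‖en (f n)‖) l (𝓝 (‖en a‖)) := by
    have : ∀ b : HSp e, Sa b → ‖en b‖ = Real.sqrt ‖ex (-b)‖ := fun b hb => by
      rw [← norm_en_sq hb, Real.sqrt_sq (norm_nonneg _)]
    rw [this a ha]
    simp only [fun n => this (f n) (hf n)]
    exact (Real.continuous_sqrt.tendsto _).comp h1.norm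
  rw [tendsto_iff_norm_sub_tendsto_zero]
  have h3 : Tendsto (fun n => ‖en (f n)‖ * (‖en a‖ * ‖w n‖)) l (𝓝 0) := by
    have := h2.mul ((tendsto_const_nhds (x := ‖en a‖)).mul ht.norm)
    simpa using this
  refine squeeze_zero (fun _ => norm_nonneg _) (fun n => ?_) h3
  refine (Sc_lower (hf n) ha _).trans ?_
  rw [Sc_sub_eq (hw n)]
  refine (norm_Lm_le _ _).trans ?_
  gcongr
  exact norm_Rm_le _ _

lemma tendsto_act {g : α → H →L[ℂ] H} {g0 : H →L[ℂ] H} (hg : ∀ n, MemGL2 e (g n)) (hg0 : MemGL2 e g0)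
    {f : α → HSp e} {a : HSp e} (hf : ∀ n, Sa (f n)) (ha : Sa a)
    (h : HTend e l g g0) (h' : Tendsto f l (𝓝 a)) : Tendsto (fun n => act (g n) (f n)) l (𝓝 (act g0 a)) := by
  refine tendsto_of_htend_ex (fun _ => act_sa _ _) (act_sa _ _) ?_
  rw [ex_act hg0 ha]
  simp only [fun n => ex_act (hg n) (hf n)]
  exact (h.mul (htend_ex h')).mul h.star

lemma htend_en {f : α → HSp e} {a : HSp e} (h : Tendsto f l (𝓝 a)) : HTend e l (fun n => en (f n)) (en a) := by
  simp only [← ex_neg_half]; exact htend_ex (h.const_smul _)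
lemma htend_eh {f : α → HSp e} {a : HSp e} (h : Tendsto f l (𝓝 a)) : HTend e l (fun n => eh (f n)) (eh a) := by
  simp only [← ex_half]; exact htend_ex (h.const_smul _)

lemma tendsto_dd {f g : α → HSp e} {a b : HSp e} (hf : ∀ n, Sa (f n)) (ha : Sa a) (hg : ∀ n, Sa (g n)) (hb : Sa b)
    (h : Tendsto f l (𝓝 a)) (h' : Tendsto g l (𝓝 b)) : Tendsto (fun n => dd (f n) (g n)) l (𝓝 (dd a b)) :=
  (tendsto_act (fun n => memGL2_en _) (memGL2_en _) hg hb (htend_en h) h').norm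

/-- derivative of the logarithm along a curve -/
lemma hasDerivAt_log {γ : ℝ → HSp e} {t : ℝ} (hγ : ∀ s, Sa (γ s)) {w : ℝ → HSp e} {r : HSp e}
    (hw : ∀ s, ex (γ s) - ex (γ t) = ((s - t) • w s).op) (hr : Tendsto w (𝓝[≠] t) (𝓝 r)) :
    ∃ γ' : HSp e, HasDerivAt γ γ' t ∧ Sc (γ t) (γ t) γ' = Lm e (en (γ t)) (Rm e (en (γ t)) r) := by
  have hs : Tendsto (fun s : ℝ => s - t) (𝓝[≠] t) (𝓝 0) := by
    have : Tendsto (fun s : ℝ => s - t) (𝓝 t) (𝓝 (t - t)) := (continuous_id.sub continuous_const).tendsto t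
    rw [sub_self] at this
    exact this.mono_left nhdsWithin_le_nhds
  have hc : Tendsto γ (𝓝[≠] t) (𝓝 (γ t)) := by
    refine tendsto_of_htend_ex hγ (hγ t) ⟨fun s => (s - t) • w s, hw, ?_⟩
    simpa using hs.smul hr
  obtain ⟨γ', -, hγ'⟩ := sc_surj (Tt (γ t) (γ t)) (Tt_symm (hγ t) (hγ t)) ⊤ isClosed_univ (fun _ _ => trivial)
    (w := Lm e (en (γ t)) (Rm e (en (γ t)) r)) trivial
  refine ⟨γ', ?_, hγ'⟩
  rw [hasDerivAt_iff_tendsto_slope, tendsto_iff_norm_sub_tendsto_zero]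
  have h1 : Tendsto (fun s => Sc (γ s) (γ t) γ') (𝓝[≠] t) (𝓝 (Lm e (en (γ t)) (Rm e (en (γ t)) r))) := by
    rw [← hγ']
    exact tendsto_Sc hc tendsto_const_nhds tendsto_const_nhds
  have h3 : Tendsto (fun s => Lm e (en (γ s)) (Rm e (en (γ t)) (w s))) (𝓝[≠] t)
      (𝓝 (Lm e (en (γ t)) (Rm e (en (γ t)) r))) :=
    tendsto_Lm ((en_continuous.tendsto _).comp hc) (tendsto_Rm tendsto_const_nhds hr)
  have h2 : Tendsto (fun s => ‖Lm e (en (γ s)) (Rm e (en (γ t)) (w s)) - Sc (γ s) (γ t) γ'‖) (𝓝[≠] t) (𝓝 0) := by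
    have h4 := (h3.sub h1).norm
    rw [sub_self, norm_zero] at h4
    exact h4
  refine squeeze_zero' (Eventually.of_forall fun _ => norm_nonneg _) ?_ h2
  filter_upwards [self_mem_nhdsWithin] with s hs
  have hs' : s - t ≠ 0 := sub_ne_zero.2 hs
  refine (Sc_lower (hγ s) (hγ t) _).trans (le_of_eq ?_)
  rw [map_sub, slope_def_module, map_smul, Sc_sub_eq (hw s), map_smul, map_smul, smul_smul, inv_mul_cancel₀ hs', one_smul]

/-- slope of the one-parameter group at zero -/
lemma ex_slope (K : HSp e) : ∃ w : ℝ → HSp e, (∀ s, ex (s • K) - 1 = (s • w s).op) ∧ Tendsto w (𝓝 0) (𝓝 K) := by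
  refine ⟨fun s => Lm e (eh (s • K)) (Sc (s • K) 0 K), fun s => ?_, ?_⟩
  · rw [← ex_zero (e := e), ex_sub_ex, sub_zero, map_smul, map_smul, map_smul, op_Lm]
    have : eh (0 : HSp e) = 1 := by simp [eh]
    rw [this]; simp
  · have h0 : Tendsto (fun s : ℝ => s • K) (𝓝 0) (𝓝 0) := by
      have : Continuous (fun s : ℝ => s • K) := by fun_prop
      simpa using this.tendsto 0
    have h2 := tendsto_Lm ((eh_continuous.tendsto (0 : HSp e)).comp h0)
      (tendsto_Sc h0 (tendsto_const_nhds (x := (0 : HSp e))) (tendsto_const_nhds (x := K)))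
    have h3 : Sc (0 : HSp e) 0 K = K := by
      unfold Sc
      rw [pw_of_apply_eq_zero scC_bd, scC_zero, one_smul]
      simp [Tt]
    have h4 : Lm e (eh (0 : HSp e)) (Sc (0 : HSp e) 0 K) = K := by
      rw [h3]; apply HSp.op_injective; rw [op_Lm]; simp [eh]
    rw [h4] at h2
    exact h2

end Conv
end Part6

section Part7
open Filter Topology
section EMI
variable {e : HilbertBasis ι ℂ H}

lemma tendsto_sub_nhdsNE (t : ℝ) : Tendsto (fun s : ℝ => s - t) (𝓝[≠] t) (𝓝 0) := by
  have h : Tendsto (fun s : ℝ => s - t) (𝓝 t) (𝓝 (t - t)) := (continuous_id.sub continuous_const).tendsto t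
  rw [sub_self] at h
  exact h.mono_left nhdsWithin_le_nhds

lemma eh_zero : eh (0 : HSp e) = 1 := by simp [eh]

lemma geo_deriv {a K : HSp e} (ha : Sa a) (hK : Sa K) (t : ℝ) :
    ∃ γ' : HSp e, HasDerivAt (fun s : ℝ => act (eh a) (s • K)) γ' t ∧ ‖γ'‖ ≤ ‖K‖ := by
  obtain ⟨w, hw, hwt⟩ := ex_slope K
  have hex : ∀ s : ℝ, ex (act (eh a) (s • K)) = eh a * ex (s • K) * eh a := fun s => by
    rw [ex_act (memGL2_eh a) (hK.smul s), ha.eh]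
  obtain ⟨γ', h1, h2⟩ := hasDerivAt_log (γ := fun s : ℝ => act (eh a) (s • K)) (t := t)
    (w := fun s => Lm e (eh a * ex (t • K)) (Rm e (eh a) (w (s - t))))
    (r := Lm e (eh a * ex (t • K)) (Rm e (eh a) K)) (fun s => act_sa _ _) (fun s => by
      rw [hex, hex, map_smul, op_Lm, op_Rm]
      have h := hw (s - t)
      rw [map_smul] at h
      have h3 : ex (s • K) = ex (t • K) * ex ((s - t) • K) := by
        rw [← ex_add_smul]; congr 2; ring
      rw [h3, show eh a * (ex (t • K) * ex ((s - t) • K)) * eh a - eh a * ex (t • K) * eh a =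
        eh a * ex (t • K) * ((ex ((s - t) • K) - 1) * eh a) by noncomm_ring, h]
      simp) (tendsto_Lm tendsto_const_nhds (tendsto_Rm tendsto_const_nhds (hwt.comp (tendsto_sub_nhdsNE t))))
  refine ⟨γ', h1, (Sc_lower (act_sa (eh a) (t • K)) (act_sa (eh a) (t • K)) γ').trans ?_⟩
  rw [h2]
  have hu := unitary_of ((memGL2_eh a).mul (memGL2_eh (t • K))) sa_zero (act_sa (eh a) (t • K)) (by
    rw [hex, ex_zero, star_mul, ha.eh, (hK.smul t).eh, ← eh_mul_eh]; noncomm_ring)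
  rw [eh_zero, mul_one] at hu
  set b := act (eh a) (t • K) with hb
  have hb' : Sa b := act_sa _ _
  have hcomm : eh (t • K) * K.op = K.op * eh (t • K) := by
    rw [← ex_half]
    unfold ex
    exact (((Commute.refl K.op).smul_left _).smul_left _ |>.exp_left).eq |> fun h => by simpa using h
  have : Lm e (en b) (Rm e (en b) (Lm e (eh a * ex (t • K)) (Rm e (eh a) K))) =
      Lm e (en b * (eh a * eh (t • K))) (Rm e (star (en b * (eh a * eh (t • K)))) K) := by
    apply HSp.op_injective
    simp only [op_Lm, op_Rm, star_mul, ha.eh, hb'.en, (hK.smul t).eh]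
    rw [← eh_mul_eh, show en b * (eh a * (eh (t • K) * eh (t • K)) * (K.op * eh a) * en b) =
      en b * (eh a * eh (t • K) * (eh (t • K) * K.op) * eh a * en b) by noncomm_ring, hcomm]
    noncomm_ring
  rw [this, norm_Lm_unitary hu.1, norm_Rm_unitary (by simpa using hu.1)]

lemma act_eh_zero {a : HSp e} (ha : Sa a) : act (eh a) 0 = a :=
  act_unique ha (by rw [ex_zero, mul_one, ha.eh, eh_mul_eh])

lemma act_eh_en {a b : HSp e} (hb : Sa b) : act (eh a) (act (en a) b) = b := by
  rw [act_mul (memGL2_eh _) (memGL2_en _) hb, eh_mul_en, act_one hb]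

lemma act_en_eh {a b : HSp e} (hb : Sa b) : act (en a) (act (eh a) b) = b := by
  rw [act_mul (memGL2_en _) (memGL2_eh _) hb, en_mul_eh, act_one hb]

/-- exponential metric increasing property -/
lemma emi {a b : HSp e} (ha : Sa a) (hb : Sa b) : ‖b - a‖ ≤ dd a b := by
  choose γ' h1 h2 using fun t => geo_deriv ha (act_sa (en a) b) t
  have := norm_image_sub_le_of_norm_deriv_le_segment_01' (fun t _ => (h1 t).hasDerivWithinAt) (fun t _ => h2 t)
  rwa [one_smul, zero_smul, act_eh_zero ha, act_eh_en hb] at this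

lemma dd_triangle {a b c : HSp e} (ha : Sa a) (hb : Sa b) (hc : Sa c) : dd a b ≤ dd a c + dd c b := by
  rw [← dd_act (memGL2_en a) ha hb, ← dd_act (memGL2_en a) ha hc, ← dd_act (memGL2_en a) hc hb, act_en_self ha,
    dd_zero_left (act_sa _ _), dd_zero_left (act_sa _ _)]
  have h1 := emi (act_sa (en a) c) (act_sa (en a) b)
  have h2 := norm_sub_norm_le (act (en a) b) (act (en a) c)
  linarith

lemma eq_of_dd {a b : HSp e} (ha : Sa a) (hb : Sa b) (h : dd a b = 0) : a = b := by
  have := emi ha hb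
  rw [h] at this
  exact (sub_eq_zero.1 (norm_le_zero_iff.1 this)).symm

lemma lts_deriv {X Y : HSp e} (hX : Sa X) (hY : Sa Y) (t : ℝ) :
    ∃ γ' : HSp e, HasDerivAt (fun s : ℝ => act (ex (s • X)) Y) γ' t ∧
      Sc (act (ex (t • X)) Y) (act (ex (t • X)) Y) γ' =
        pw chC (Tt (act (ex (t • X)) Y) (act (ex (t • X)) Y)) X := by
  obtain ⟨w, hw, hwt⟩ := ex_slope X
  have hex : ∀ s : ℝ, ex (act (ex (s • X)) Y) = ex (s • X) * ex Y * ex (s • X) := fun s => by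
    rw [ex_act (memGL2_ex _) hY, (hX.smul s).ex]
  set b := act (ex (t • X)) Y with hb
  have hb' : Sa b := act_sa _ _
  have h0 : Tendsto (fun s : ℝ => ex ((s - t) • X)) (𝓝[≠] t) (𝓝 1) := by
    have h5 : Tendsto (fun s : ℝ => (s - t) • X) (𝓝[≠] t) (𝓝 ((0:ℝ) • X)) := (tendsto_sub_nhdsNE t).smul_const X
    have := (ex_continuous.tendsto ((0:ℝ) • X)).comp h5
    rwa [zero_smul, ex_zero] at this
  have h6 := hwt.comp (tendsto_sub_nhdsNE t)
  obtain ⟨γ', h1, h2⟩ := hasDerivAt_log (γ := fun s : ℝ => act (ex (s • X)) Y) (t := t)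
    (w := fun s => Rm e (ex b * ex ((s - t) • X)) (w (s - t)) + Lm e (ex b) (w (s - t)))
    (r := Rm e (ex b * 1) X + Lm e (ex b) X) (fun s => act_sa _ _) (fun s => by
      have h := hw (s - t)
      rw [map_smul] at h
      have h3 : ex (s • X) = ex (t • X) * ex ((s - t) • X) := by
        rw [← ex_add_smul]; congr 2; ring
      have h4 : ex (s • X) = ex ((s - t) • X) * ex (t • X) := by
        rw [← ex_add_smul]; congr 2; ring
      have h5 : ex (s • X) * ex Y * ex (s • X) = ex ((s - t) • X) * ex b * ex ((s - t) • X) := by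
        rw [hex t]
        conv_lhs => rw [h3]
        conv_lhs => arg 1; rw [← h3, h4]
        noncomm_ring
      rw [hex s, h5, ← hb, map_smul, map_add, op_Rm, op_Lm, smul_add, ← smul_mul_assoc, ← mul_smul_comm, ← h]
      noncomm_ring)
    ((tendsto_Rm (tendsto_const_nhds.mul h0) h6).add (tendsto_Lm tendsto_const_nhds h6))
  refine ⟨γ', h1, ?_⟩
  rw [← hb] at h2
  rw [h2]
  apply HSp.op_injective
  rw [Ch_op, map_add, map_add, map_add, op_Lm, op_Rm, op_Rm, op_Lm, op_Rm, op_Lm, mul_one, ← eh_mul_eh,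
    show en b * (X.op * (eh b * eh b) * en b) = en b * X.op * eh b * (eh b * en b) by noncomm_ring,
    show en b * (eh b * eh b * X.op * en b) = (en b * eh b) * eh b * X.op * en b by noncomm_ring, eh_mul_en, en_mul_eh]
  rw [mul_one, one_mul, add_comm]

lemma norm_Tt_le (a : HSp e) : ‖Tt a a‖ ≤ ‖a‖ := by
  refine ContinuousLinearMap.opNorm_le_bound _ (norm_nonneg _) fun v => ?_
  rw [Tt, ContinuousLinearMap.smul_apply, ContinuousLinearMap.sub_apply, norm_smul]
  have h1 := norm_Lm_le a.op v
  have h2 := norm_Rm_le a.op v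
  have h3 := norm_sub_le (Lm e a.op v) (Rm e a.op v)
  have h4 : ‖a.op‖ * ‖v‖ ≤ ‖a‖ * ‖v‖ := by gcongr; exact a.norm_op_le
  norm_num
  linarith

lemma Tt_sub (a b : HSp e) : Tt a a - Tt b b = Tt (a - b) (a - b) := by
  unfold Tt; rw [map_sub, map_sub, map_sub]; module

/-- a closed Lie triple system (squared-bracket version) in logarithmic coordinates -/
structure LTS (K : Submodule ℝ (HSp e)) : Prop where
  closed : IsClosed (K : Set (HSp e))
  sa : ∀ v ∈ K, Sa v
  brk : ∀ X ∈ K, ∀ Y ∈ K, Tt X X (Tt X X Y) ∈ K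

lemma LTS.act_mem {K : Submodule ℝ (HSp e)} (hK : LTS K) {X Y : HSp e} (hX : X ∈ K) (hY : Y ∈ K) :
    act (ex X) Y ∈ K := by
  have : CompleteSpace K := hK.closed.completeSpace_coe
  have hXs := hK.sa X hX
  have hYs := hK.sa Y hY
  choose γ' h1 h2 using fun t => lts_deriv hXs hYs t
  set γ : ℝ → HSp e := fun s => act (ex (s • X)) Y with hγ
  have hγs : ∀ s, Sa (γ s) := fun s => act_sa _ _
  have hcont : Continuous γ := continuous_iff_continuousAt.2 fun t => (h1 t).continuousAt
  obtain ⟨R, hR⟩ := (isCompact_Icc (a := (0:ℝ)) (b := 1)).exists_bound_of_continuousOn hcont.continuousOn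
  let Q := Kᗮ.starProjection
  have hQ : ∀ v, Q v = v - K.starProjection v := fun v => K.starProjection_orthogonal_val v
  have hQK : ∀ v ∈ K, Q v = 0 := fun v hv => by
    rw [hQ, Submodule.starProjection_eq_self_iff.2 hv, sub_self]
  have key := eq_zero_of_abs_deriv_le_mul_abs_self_of_eq_zero_right (f := fun t => Q (γ t)) (f' := fun t => Q (γ' t))
    (K := 2 * Real.exp R * (‖X‖ + (2 * Real.exp R * R * ‖X‖ + ‖pw chC (0 : HSp e →L[ℝ] HSp e) X‖)))
    (a := 0) (b := 1) (Q.continuous.comp hcont).continuousOn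
    (fun t _ => (Q.hasFDerivAt.comp_hasDerivAt t (h1 t)).hasDerivWithinAt)
    (hQK _ (by rw [hγ]; simpa [ex_zero, act_one hYs] using hY)) (fun t ht => by
      have hRt : ‖γ t‖ ≤ R := hR t ⟨ht.1, ht.2.le⟩
      have hR0 : 0 ≤ R := (norm_nonneg _).trans hRt
      set δ := K.starProjection (γ t) with hδ
      have hδK : δ ∈ K := K.starProjection_apply_mem (γ t)
      have hδR : ‖δ‖ ≤ R := (K.norm_starProjection_apply_le (γ t)).trans hRt
      have hδs := hK.sa δ hδK
      obtain ⟨z, hz, hz2⟩ := sc_surj (Tt δ δ) (Tt_symm hδs hδs) K hK.closed (hK.brk δ hδK)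
        (pw_mem chC_bd (fun n hn => chC_odd hn) (Tt δ δ) K hK.closed (hK.brk δ hδK) hX)
      have e1 : Q (γ' t) = Q (γ' t - z) := by rw [map_sub, hQK z hz, sub_zero]
      have e2 : ‖Q (γ' t)‖ ≤ ‖γ' t - z‖ := by rw [e1]; exact Kᗮ.norm_starProjection_apply_le _
      have e3 : ‖γ' t - z‖ ≤ ‖Sc (γ t) (γ t) (γ' t - z)‖ := Sc_lower (hγs t) (hγs t) _
      have e4 : Sc (γ t) (γ t) (γ' t - z) = (pw chC (Tt (γ t) (γ t)) - pw chC (Tt δ δ)) X -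
          (pw scC (Tt (γ t) (γ t)) - pw scC (Tt δ δ)) z := by
        rw [map_sub, h2 t, ContinuousLinearMap.sub_apply, ContinuousLinearMap.sub_apply, hz2]
        show _ - pw scC (Tt (γ t) (γ t)) z = _
        abel
      have e5 : ‖Tt (γ t) (γ t) - Tt δ δ‖ ≤ ‖Q (γ t)‖ := by
        rw [Tt_sub, hQ]; exact norm_Tt_le _
      have l1 := pw_lipschitz chC_bd ((norm_Tt_le _).trans hRt) ((norm_Tt_le _).trans hδR)
      have l2 := pw_lipschitz scC_bd ((norm_Tt_le _).trans hRt) ((norm_Tt_le _).trans hδR)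
      have l3 := pw_lipschitz (A := Tt δ δ) (B := 0) chC_bd ((norm_Tt_le _).trans hδR) (by simpa using hR0)
      have hE : 0 < Real.exp R := Real.exp_pos R
      have b1 : ‖z‖ ≤ 2 * Real.exp R * R * ‖X‖ + ‖pw chC (0 : HSp e →L[ℝ] HSp e) X‖ := by
        refine (sc_lower (Tt δ δ) (Tt_symm hδs hδs) z).trans ?_
        rw [hz2]
        have : pw chC (Tt δ δ) X = (pw chC (Tt δ δ) - pw chC 0) X + pw chC (0 : HSp e →L[ℝ] HSp e) X := by
          rw [ContinuousLinearMap.sub_apply]; abel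
        rw [this]
        refine (norm_add_le _ _).trans ?_
        gcongr
        refine (ContinuousLinearMap.le_opNorm _ _).trans ?_
        gcongr
        refine l3.trans ?_
        rw [sub_zero]
        gcongr
        exact (norm_Tt_le _).trans hδR
      refine e2.trans (e3.trans ?_)
      rw [e4]
      refine (norm_sub_le _ _).trans ?_
      have c1 : ‖(pw chC (Tt (γ t) (γ t)) - pw chC (Tt δ δ)) X‖ ≤ 2 * Real.exp R * ‖Q (γ t)‖ * ‖X‖ := by
        refine (ContinuousLinearMap.le_opNorm _ _).trans ?_
        gcongr
        refine l1.trans ?_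
        gcongr
      have c2 : ‖(pw scC (Tt (γ t) (γ t)) - pw scC (Tt δ δ)) z‖ ≤ 2 * Real.exp R * ‖Q (γ t)‖ *
          (2 * Real.exp R * R * ‖X‖ + ‖pw chC (0 : HSp e →L[ℝ] HSp e) X‖) := by
        refine (ContinuousLinearMap.le_opNorm _ _).trans ?_
        gcongr
        refine l2.trans ?_
        gcongr
      refine (add_le_add c1 c2).trans (le_of_eq ?_)
      ring)
  have k1 := key 1 ⟨zero_le_one, le_rfl⟩
  simp only [hQ] at k1
  have k2 : γ 1 ∈ K := by
    rw [sub_eq_zero.1 k1]; exact K.starProjection_apply_mem _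
  simpa [hγ] using k2

end EMI
end Part7

section Part8
open Filter Topology
section Mostow
variable {e : HilbertBasis ι ℂ H} {K : Submodule ℝ (HSp e)}

lemma LTS.eh_mem (hK : LTS K) {X Y : HSp e} (hX : X ∈ K) (hY : Y ∈ K) : act (eh X) Y ∈ K := by
  rw [← ex_half]; exact hK.act_mem (K.smul_mem _ hX) hY
lemma LTS.en_mem (hK : LTS K) {X Y : HSp e} (hX : X ∈ K) (hY : Y ∈ K) : act (en X) Y ∈ K := by
  rw [← ex_neg_half]; exact hK.act_mem (K.smul_mem _ hX) hY

lemma LTS.semiparallelogram (hK : LTS K) {X X' c : HSp e} (hX : X ∈ K) (hX' : X' ∈ K) (hc : Sa c) :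
    ∃ m ∈ K, dd X X' ^ 2 / 2 + 2 * dd m c ^ 2 ≤ dd X c ^ 2 + dd X' c ^ 2 := by
  have hXs := hK.sa X hX
  have hXs' := hK.sa X' hX'
  set V := act (en X) X' with hV
  have hVK : V ∈ K := hK.en_mem hX hX'
  set W := (1/2:ℝ) • V with hW
  have hWK : W ∈ K := K.smul_mem _ hVK
  have hWs := hK.sa W hWK
  have hVs := hK.sa V hVK
  have hV2 : V = (2:ℝ) • W := by rw [hW, smul_smul]; norm_num
  refine ⟨act (eh X) W, hK.eh_mem hX hWK, ?_⟩
  set c1 := act (en X) c with hc1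
  set c2 := act (en W) c1 with hc2
  have a1 : act (en W) 0 = -W := act_unique hWs.neg (by rw [ex_zero, mul_one, hWs.en, en_mul_en])
  have a2 : act (en W) V = W := by
    apply act_unique hWs
    rw [hWs.en, hV2, two_smul]
    have : ex (W + W) = ex W * ex W := by
      have := ex_add_smul 1 1 W
      rw [add_smul] at this
      simpa using this
    rw [this, ← eh_mul_eh, show en W * (eh W * eh W * (eh W * eh W)) * en W =
      (en W * eh W) * (eh W * eh W) * (eh W * en W) by noncomm_ring, eh_mul_en, en_mul_eh]; simp
  have d1 : dd X c = dd (-W) c2 := by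
    rw [← dd_act (memGL2_en X) hXs hc, ← dd_act (memGL2_en W) (act_sa _ _) (act_sa _ _), act_en_self hXs, a1]
  have d2 : dd X' c = dd W c2 := by
    rw [← dd_act (memGL2_en X) hXs' hc, ← dd_act (memGL2_en W) (act_sa _ _) (act_sa _ _), ← hV, a2]
  have d3 : dd (act (eh X) W) c = ‖c2‖ := by
    rw [← dd_act (memGL2_en X) (act_sa _ _) hc, ← dd_act (memGL2_en W) (act_sa _ _) (act_sa _ _),
      act_en_eh hWs, act_en_self hWs, dd_zero_left (act_sa _ _)]
  have d4 : dd X X' = 2 * ‖W‖ := by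
    show ‖V‖ = _
    rw [hV2, norm_smul]; simp
  have e1 := emi hWs.neg (act_sa (en W) c1)
  have e2 := emi hWs (act_sa (en W) c1)
  rw [sub_neg_eq_add] at e1
  have pl := parallelogram_law_with_norm ℝ c2 W
  rw [d1, d2, d3, d4]
  have f1 : ‖c2 + W‖ ^ 2 ≤ dd (-W) c2 ^ 2 := pow_le_pow_left₀ (norm_nonneg _) e1 2
  have f2 : ‖c2 - W‖ ^ 2 ≤ dd W c2 ^ 2 := pow_le_pow_left₀ (norm_nonneg _) e2 2
  nlinarith

lemma LTS.exists_min (hK : LTS K) {c : HSp e} (hc : Sa c) : ∃ Z ∈ K, ∀ Z' ∈ K, dd Z c ≤ dd Z' c := by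
  set S : Set ℝ := (fun Z => dd Z c) '' (K : Set (HSp e)) with hS
  have hne : S.Nonempty := ⟨_, 0, K.zero_mem, rfl⟩
  have hbd : BddBelow S := ⟨0, by rintro _ ⟨Z, -, rfl⟩; exact dd_nonneg _ _⟩
  set r := sInf S with hr
  have hr0 : 0 ≤ r := le_csInf hne (by rintro _ ⟨Z, -, rfl⟩; exact dd_nonneg _ _)
  have hrle : ∀ Z ∈ K, r ≤ dd Z c := fun Z hZ => csInf_le hbd ⟨Z, hZ, rfl⟩
  have hex : ∀ n : ℕ, ∃ Z ∈ K, dd Z c < r + 1 / ((n:ℝ) + 1) := by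
    intro n
    obtain ⟨_, ⟨Z, hZ, rfl⟩, h⟩ := exists_lt_of_csInf_lt hne (show sInf S < r + 1 / ((n:ℝ) + 1) by
      have : (0:ℝ) < 1 / ((n:ℝ) + 1) := by positivity
      linarith)
    exact ⟨Z, hZ, h⟩
  choose Z hZK hZ using hex
  have hε : Tendsto (fun n : ℕ => 1 / ((n:ℝ) + 1)) atTop (𝓝 0) := tendsto_one_div_add_atTop_nhds_zero_nat
  have hcau : CauchySeq Z := by
    refine cauchySeq_of_le_tendsto_0 (fun N : ℕ => Real.sqrt (4 * ((r + 1 / ((N:ℝ) + 1)) ^ 2 - r ^ 2))) ?_ ?_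
    · intro n m N hn hm
      apply Real.le_sqrt_of_sq_le
      rw [dist_eq_norm]
      obtain ⟨mid, hmid, hsp⟩ := hK.semiparallelogram (hZK m) (hZK n) hc
      have h1 : ‖Z n - Z m‖ ^ 2 ≤ dd (Z m) (Z n) ^ 2 :=
        pow_le_pow_left₀ (norm_nonneg _) (emi (hK.sa _ (hZK m)) (hK.sa _ (hZK n))) 2
      have h2 : r ^ 2 ≤ dd mid c ^ 2 := pow_le_pow_left₀ hr0 (hrle mid hmid) 2
      have h3 : ∀ k : ℕ, N ≤ k → dd (Z k) c ^ 2 ≤ (r + 1 / ((N:ℝ) + 1)) ^ 2 := by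
        intro k hk
        refine pow_le_pow_left₀ (dd_nonneg _ _) ((hZ k).le.trans ?_) 2
        gcongr
      have := h3 n hn
      have := h3 m hm
      linarith
    · have h5 : Tendsto (fun N : ℕ => 4 * ((r + 1 / ((N:ℝ) + 1)) ^ 2 - r ^ 2)) atTop (𝓝 (4 * ((r + 0) ^ 2 - r ^ 2))) :=
        (((hε.const_add r).pow 2).sub_const _).const_mul 4
      have h6 := (Real.continuous_sqrt.tendsto _).comp h5
      rw [add_zero, sub_self, mul_zero, Real.sqrt_zero] at h6
      exact h6
  obtain ⟨Z0, hZ0⟩ := cauchySeq_tendsto_of_complete hcau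
  have hZ0K : Z0 ∈ K := hK.closed.mem_of_tendsto hZ0 (Eventually.of_forall hZK)
  refine ⟨Z0, hZ0K, fun Z' hZ' => le_trans ?_ (hrle Z' hZ')⟩
  have h1 := tendsto_dd (fun n => hK.sa _ (hZK n)) (hK.sa _ hZ0K) (fun _ => hc) hc hZ0 (tendsto_const_nhds (x := c))
  have h2 : Tendsto (fun n : ℕ => r + 1 / ((n:ℝ) + 1)) atTop (𝓝 (r + 0)) := hε.const_add r
  rw [add_zero] at h2
  exact le_of_tendsto_of_tendsto' h1 h2 (fun n => (hZ n).le)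

lemma first_variation {C X : HSp e} (hC : Sa C) (hX : Sa X) (h : ∀ t : ℝ, ‖C‖ ≤ ‖act (ex (t • X)) C‖) :
    ⟪X, C⟫_ℝ = 0 := by
  obtain ⟨η', h1, h2⟩ := lts_deriv hX hC 0
  have h0 : act (ex ((0:ℝ) • X)) C = C := by rw [zero_smul, ex_zero, act_one hC]
  rw [h0] at h2
  have h3 := h1.norm_sq
  have h4 : IsLocalMin (fun t : ℝ => ‖act (ex (t • X)) C‖ ^ 2) 0 := by
    refine Eventually.of_forall fun t => ?_
    show ‖act (ex ((0:ℝ) • X)) C‖ ^ 2 ≤ _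
    rw [h0]
    exact pow_le_pow_left₀ (norm_nonneg _) (h t) 2
  have h5 := h4.hasDerivAt_eq_zero h3
  rw [h0] at h5
  have hs : Sc C C C = C := by
    unfold Sc; rw [pw_of_apply_eq_zero scC_bd _ _ (Tt_self C), scC_zero, one_smul]
  have hch : pw chC (Tt C C) C = (2:ℝ) • C := by
    rw [pw_of_apply_eq_zero chC_bd _ _ (Tt_self C), chC_zero]
  have h6 : ⟪C, η'⟫_ℝ = 2 * ⟪C, X⟫_ℝ := by
    calc ⟪C, η'⟫_ℝ = ⟪Sc C C C, η'⟫_ℝ := by rw [hs]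
      _ = ⟪C, Sc C C η'⟫_ℝ := pw_symm scC_bd _ (Tt_symm hC hC) _ _
      _ = ⟪C, pw chC (Tt C C) X⟫_ℝ := by rw [h2]
      _ = ⟪pw chC (Tt C C) C, X⟫_ℝ := (pw_symm chC_bd _ (Tt_symm hC hC) _ _).symm
      _ = 2 * ⟪C, X⟫_ℝ := by rw [hch, inner_smul_left]; simp
  rw [h6] at h5
  rw [real_inner_comm]
  linarith

lemma LTS.exists_decomp (hK : LTS K) {c : HSp e} (hc : Sa c) :
    ∃ Z ∈ K, ∃ C : HSp e, Sa C ∧ (∀ X ∈ K, ⟪X, C⟫_ℝ = 0) ∧ act (eh Z) C = c := by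
  obtain ⟨Z, hZ, hmin⟩ := hK.exists_min hc
  refine ⟨Z, hZ, act (en Z) c, act_sa _ _, fun X hX => ?_, act_eh_en hc⟩
  refine first_variation (act_sa _ _) (hK.sa X hX) fun t => ?_
  have hW : (-2 * t) • X ∈ K := K.smul_mem _ hX
  have h1 := hmin _ (hK.eh_mem hZ hW)
  rw [← dd_act (memGL2_en Z) (act_sa _ _) hc, act_en_eh (hK.sa _ hW)] at h1
  have h2 : ex (t • X) = en ((-2 * t) • X) := by
    rw [← ex_neg_half, smul_smul]; congr 2; ring
  rw [h2]
  exact h1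

lemma LTS.pythagoras (hK : LTS K) {Z Z' C : HSp e} (hZ : Z ∈ K) (hZ' : Z' ∈ K) (hC : Sa C)
    (hCK : ∀ X ∈ K, ⟪X, C⟫_ℝ = 0) : ‖C‖ ^ 2 + dd Z Z' ^ 2 ≤ dd Z' (act (eh Z) C) ^ 2 := by
  have hV : act (en Z) Z' ∈ K := hK.en_mem hZ hZ'
  have h1 : dd Z' (act (eh Z) C) = dd (act (en Z) Z') C := by
    rw [← dd_act (memGL2_en Z) (hK.sa _ hZ') (act_sa _ _), act_en_eh hC]
  have h2 := emi (hK.sa _ hV) hC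
  rw [h1]
  refine le_trans (le_of_eq ?_) (pow_le_pow_left₀ (norm_nonneg _) h2 2)
  rw [norm_sub_sq_real, real_inner_comm, hCK _ hV]
  simp [dd]

lemma dd_decomp {Z C : HSp e} (hZ : Sa Z) (hC : Sa C) : dd Z (act (eh Z) C) = ‖C‖ := by
  unfold dd; rw [act_en_eh hC]

lemma LTS.stability (hK : LTS K) {Z Z' C C' : HSp e} (hZ : Z ∈ K) (hZ' : Z' ∈ K) (hC : Sa C) (hC' : Sa C')
    (hCK : ∀ X ∈ K, ⟪X, C⟫_ℝ = 0) (hCK' : ∀ X ∈ K, ⟪X, C'⟫_ℝ = 0) :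
    ‖Z' - Z‖ ^ 2 ≤ 2 * dd (act (eh Z) C) (act (eh Z') C') * ‖C‖ + 2 * dd (act (eh Z) C) (act (eh Z') C') ^ 2 := by
  have hZs := hK.sa _ hZ
  have hZs' := hK.sa _ hZ'
  set c := act (eh Z) C with hc
  set c' := act (eh Z') C' with hc'
  have p1 := hK.pythagoras hZ hZ' hC hCK
  have p2 := hK.pythagoras hZ' hZ hC' hCK'
  rw [← hc] at p1
  rw [← hc', dd_comm hZs' hZs] at p2
  have t1 := dd_triangle hZs' (act_sa (eh Z) C) (act_sa (eh Z') C')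
  have t2 := dd_triangle hZs (act_sa (eh Z') C') (act_sa (eh Z) C)
  rw [← hc, ← hc', dd_decomp hZs' hC', dd_comm (act_sa _ _) (act_sa _ _)] at t1
  rw [← hc, ← hc', dd_decomp hZs hC] at t2
  rw [← hc, ← hc'] at t1
  have n1 := dd_nonneg Z' c
  have n2 := dd_nonneg Z c'
  have n3 := dd_nonneg c c'
  have n4 := norm_nonneg C
  have n5 := norm_nonneg C'
  set η := dd c c'
  have q1 : dd Z' c ^ 2 ≤ (‖C'‖ + η) ^ 2 := pow_le_pow_left₀ n1 t1 2
  have q2 : dd Z c' ^ 2 ≤ (‖C‖ + η) ^ 2 := pow_le_pow_left₀ n2 t2 2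
  have q3 : ‖C'‖ ≤ ‖C‖ + η := by
    refine le_of_sq_le_sq ?_ (by positivity) 
    nlinarith [sq_nonneg (dd Z Z')]
  have q4 : ‖Z' - Z‖ ^ 2 ≤ dd Z Z' ^ 2 := pow_le_pow_left₀ (norm_nonneg _) (emi hZs hZs') 2
  nlinarith [mul_le_mul_of_nonneg_left q3 n3]

lemma LTS.tendsto_decomp (hK : LTS K) {α : Type*} {l : Filter α} {Z C : α → HSp e} {Z0 C0 : HSp e}
    (hZ : ∀ n, Z n ∈ K) (hC : ∀ n, Sa (C n)) (hCK : ∀ n, ∀ X ∈ K, ⟪X, C n⟫_ℝ = 0)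
    (hZ0 : Z0 ∈ K) (hC0 : Sa C0) (hCK0 : ∀ X ∈ K, ⟪X, C0⟫_ℝ = 0)
    (h : Tendsto (fun n => act (eh (Z n)) (C n)) l (𝓝 (act (eh Z0) C0))) :
    Tendsto Z l (𝓝 Z0) ∧ Tendsto C l (𝓝 C0) := by
  have h1 := tendsto_dd (fun _ => act_sa (eh Z0) C0) (act_sa _ _) (fun n => act_sa _ _) (act_sa _ _)
    (tendsto_const_nhds (x := act (eh Z0) C0)) h
  rw [dd_self (act_sa _ _)] at h1
  have hZt : Tendsto Z l (𝓝 Z0) := by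
    rw [tendsto_iff_norm_sub_tendsto_zero]
    have h2 := (((h1.const_mul 2).mul_const ‖C0‖).add ((h1.pow 2).const_mul 2))
    have h3 := (Real.continuous_sqrt.tendsto _).comp h2
    simp only [mul_zero, zero_mul, ne_eq, OfNat.ofNat_ne_zero, not_false_eq_true, zero_pow, add_zero, Real.sqrt_zero] at h3
    refine squeeze_zero (fun _ => norm_nonneg _) (fun n => ?_) h3
    exact Real.le_sqrt_of_sq_le (hK.stability hZ0 (hZ n) hC0 (hC n) hCK0 (hCK n))
  refine ⟨hZt, ?_⟩
  have h4 := tendsto_act (fun n => memGL2_en (Z n)) (memGL2_en Z0) (fun n => act_sa (eh (Z n)) (C n)) (act_sa (eh Z0) C0)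
    (htend_en hZt) h
  simpa only [fun n => act_en_eh (a := Z n) (hC n), act_en_eh hC0] using h4

lemma LTS.unique_decomp (hK : LTS K) {Z C Z0 C0 : HSp e}
    (hZ : Z ∈ K) (hC : Sa C) (hCK : ∀ X ∈ K, ⟪X, C⟫_ℝ = 0)
    (hZ0 : Z0 ∈ K) (hC0 : Sa C0) (hCK0 : ∀ X ∈ K, ⟪X, C0⟫_ℝ = 0)
    (h : act (eh Z) C = act (eh Z0) C0) : Z = Z0 ∧ C = C0 := by
  have h1 := hK.stability hZ0 hZ hC0 hC hCK0 hCK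
  rw [h, dd_self (act_sa _ _)] at h1
  have h2 : Z = Z0 := by
    have : ‖Z - Z0‖ = 0 := by nlinarith [norm_nonneg (Z - Z0)]
    exact sub_eq_zero.1 (norm_eq_zero.1 this)
  refine ⟨h2, ?_⟩
  subst h2
  have := congrArg (act (en Z)) h
  rwa [act_en_eh hC, act_en_eh hC0] at this

end Mostow
end Part8

section Part9
open Filter Topology
section Final
variable {e : HilbertBasis ι ℂ H}

/-- the subspace `E` in `HSp` -/
def EK (e : HilbertBasis ι ℂ H) (E : Submodule ℝ (H →L[ℂ] H)) : Submodule ℝ (HSp e) :=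
  E.comap (HSp.op (e := e)).toLinearMap

lemma mem_EK {E : Submodule ℝ (H →L[ℂ] H)} {v : HSp e} : v ∈ EK e E ↔ v.op ∈ E := Iff.rfl

lemma lts_EK {E : Submodule ℝ (H →L[ℂ] H)}
    (hE : ∀ X ∈ E, MemS2 e X) (hclosed : IsHSClosed e (E : Set (H →L[ℂ] H)))
    (hbrk : ∀ X ∈ E, ∀ Y ∈ E, brk X (brk X Y) ∈ E) : LTS (EK e E) := by
  have hsa : ∀ v ∈ EK e E, Sa v := fun v hv => sa_of_op (hE _ hv).1
  refine ⟨?_, hsa, ?_⟩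
  · rw [← closure_subset_iff_isClosed]
    intro v hv
    have hvs : Sa v := by
      have hcl : IsClosed {w : HSp e | Sa w} := isClosed_eq HSp.J_continuous continuous_id
      exact closure_minimal hsa hcl hv
    refine hclosed v.op ⟨hvs.op, v.isHS⟩ fun ε hε => ?_
    obtain ⟨w, hw, hd⟩ := Metric.mem_closure_iff.1 hv ε hε
    refine ⟨w.op, hw, ?_⟩
    rw [← map_sub, HSp.hsNorm_op, ← dist_eq_norm]; exact hd
  · intro X hX Y hY
    rw [mem_EK, op_Tt, op_Tt, TB_apply, TB_apply]
    have := E.smul_mem (1/4:ℝ) (hbrk _ hX _ hY)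
    unfold brk at this
    convert this using 1
    simp only [mul_smul_comm, smul_mul_assoc, ← smul_sub, smul_smul]
    norm_num

lemma mem_expSet_E {E : Submodule ℝ (H →L[ℂ] H)} (hE : ∀ X ∈ E, MemS2 e X) {a : H →L[ℂ] H} :
    a ∈ expSet (E : Set (H →L[ℂ] H)) ↔ ∃ Z ∈ EK e E, a = eh Z := by
  constructor
  · rintro ⟨X, hX, rfl⟩
    obtain ⟨v, rfl⟩ := (hE X hX).2.exists_op
    refine ⟨(2:ℝ) • v, Submodule.smul_mem _ _ hX, ?_⟩
    rw [← ex_half, smul_smul]; norm_num; rfl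
  · rintro ⟨Z, hZ, rfl⟩
    exact ⟨((1/2:ℝ) • Z).op, Submodule.smul_mem (EK e E) _ hZ, by rw [← ex_half]; rfl⟩

lemma mem_expSet_F {E : Submodule ℝ (H →L[ℂ] H)} (hE : ∀ X ∈ E, MemS2 e X) {b : H →L[ℂ] H} :
    b ∈ expSet (hsPerp e (E : Set (H →L[ℂ] H))) ↔
      ∃ C : HSp e, Sa C ∧ (∀ X ∈ EK e E, ⟪X, C⟫_ℝ = 0) ∧ b = eh C := by
  constructor
  · rintro ⟨X, ⟨hX, hX2⟩, rfl⟩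
    obtain ⟨v, rfl⟩ := hX.2.exists_op
    refine ⟨(2:ℝ) • v, (sa_of_op hX.1).smul _, fun Y hY => ?_, ?_⟩
    · have := hX2 Y.op hY
      rw [HSp.hsInner_op] at this
      rw [inner_smul_right, this, mul_zero]
    · rw [← ex_half, smul_smul]; norm_num; rfl
  · rintro ⟨C, hC, hCK, rfl⟩
    refine ⟨((1/2:ℝ) • C).op, ⟨⟨(hC.smul _).op, HSp.isHS _⟩, fun X hX => ?_⟩, by rw [← ex_half]; rfl⟩
    obtain ⟨v, rfl⟩ := (hE X hX).2.exists_op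
    rw [HSp.hsInner_op, inner_smul_right, hCK v hX, mul_zero]

lemma MemU2.gl {k : H →L[ℂ] H} (h : MemU2 e k) : MemGL2 e k :=
  ⟨⟨⟨k, star k, Unitary.mul_star_self_of_mem h.1, Unitary.star_mul_self_of_mem h.1⟩, rfl⟩, h.2⟩

lemma isHS_sub_of_gl {x y : H →L[ℂ] H} (hx : MemGL2 e x) (hy : MemGL2 e y) : IsHS e (x - y) := by
  obtain ⟨v, hv⟩ := hx.2.exists_op
  obtain ⟨w, hw⟩ := hy.2.exists_op
  have : x - y = (v - w).op := by rw [map_sub, hv, hw]; abel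
  rw [this]; exact HSp.isHS _

lemma htend_of_hsNorm {f : ℕ → H →L[ℂ] H} {a : H →L[ℂ] H} (hf : ∀ n, MemGL2 e (f n)) (ha : MemGL2 e a)
    (h : ∀ n : ℕ, hsNorm e (f n - a) < 1 / ((n:ℝ) + 1)) : HTend e atTop f a := by
  refine ⟨fun n => toHS (f n - a) (isHS_sub_of_gl (hf n) ha), fun n => (op_toHS _ _).symm, ?_⟩
  rw [tendsto_zero_iff_norm_tendsto_zero]
  refine squeeze_zero (fun _ => norm_nonneg _) (fun n => ?_) tendsto_one_div_add_atTop_nhds_zero_nat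
  rw [← HSp.hsNorm_op, op_toHS]
  exact (h n).le

lemma HTend.hsNorm {α : Type*} {l : Filter α} {f : α → H →L[ℂ] H} {a : H →L[ℂ] H} (h : HTend e l f a) :
    Tendsto (fun n => hsNorm e (f n - a)) l (𝓝 0) := by
  obtain ⟨v, hv, ht⟩ := h
  simp only [hv, HSp.hsNorm_op]
  simpa using ht.norm

lemma star_mul_prod {k : H →L[ℂ] H} (hk : MemU2 e k) {Z C : HSp e} (hZ : Sa Z) (hC : Sa C) :
    star (k * eh C * eh Z) * (k * eh C * eh Z) = ex (act (eh Z) C) := by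
  rw [ex_act (memGL2_eh Z) hC, star_mul, star_mul, hC.eh, hZ.eh, ← eh_mul_eh,
    show eh Z * (eh C * star k) * (k * eh C * eh Z) = eh Z * (eh C * (star k * k) * eh C) * eh Z by noncomm_ring,
    Unitary.star_mul_self_of_mem hk.1]
  noncomm_ring

lemma prod_cancel (k : H →L[ℂ] H) (Z C : HSp e) : k * eh C * eh Z * en Z * en C = k := by
  rw [mul_assoc _ (eh Z), eh_mul_en, mul_one, mul_assoc, eh_mul_en, mul_one]

end Final
end Part9

/-- **Mostow decomposition of `GL₂(H)`.** With `E ⊆ S₂(H)` a closed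
subspace satisfying `[X,[X,Y]] ∈ E` and `F = E^⊥`, every `x ∈ GL₂(H)` is uniquely
`x = k f e` with `k ∈ U₂(H)`, `f ∈ exp F`, `e ∈ exp E`, and `(k, f, e) ↦ k f e` is a
homeomorphism from `U₂(H) × exp F × exp E` onto `GL₂(H)` for the Hilbert–Schmidt
distance. -/
theorem statement16 (e : HilbertBasis ι ℂ H) (E : Submodule ℝ (H →L[ℂ] H))
    (hE : ∀ X ∈ E, MemS2 e X) (hclosed : IsHSClosed e (E : Set (H →L[ℂ] H)))
    (hbrk : ∀ X ∈ E, ∀ Y ∈ E, brk X (brk X Y) ∈ E) :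
    (∀ k b a : H →L[ℂ] H, MemU2 e k → b ∈ expSet (hsPerp e (E : Set (H →L[ℂ] H))) →
      a ∈ expSet (E : Set (H →L[ℂ] H)) → MemGL2 e (k * b * a)) ∧
    (∀ x : H →L[ℂ] H, MemGL2 e x →
      ∃! kfa : (H →L[ℂ] H) × (H →L[ℂ] H) × (H →L[ℂ] H),
        MemU2 e kfa.1 ∧ kfa.2.1 ∈ expSet (hsPerp e (E : Set (H →L[ℂ] H))) ∧
        kfa.2.2 ∈ expSet (E : Set (H →L[ℂ] H)) ∧
        x = kfa.1 * kfa.2.1 * kfa.2.2) ∧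
    (∀ k b a : H →L[ℂ] H, MemU2 e k → b ∈ expSet (hsPerp e (E : Set (H →L[ℂ] H))) →
      a ∈ expSet (E : Set (H →L[ℂ] H)) → ∀ ε > (0:ℝ), ∃ δ > (0:ℝ),
        ∀ k' b' a' : H →L[ℂ] H, MemU2 e k' →
          b' ∈ expSet (hsPerp e (E : Set (H →L[ℂ] H))) →
          a' ∈ expSet (E : Set (H →L[ℂ] H)) →
          hsNorm e (k' - k) < δ → hsNorm e (b' - b) < δ → hsNorm e (a' - a) < δ →
            hsNorm e (k' * b' * a' - k * b * a) < ε) ∧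
    (∀ k b a : H →L[ℂ] H, MemU2 e k → b ∈ expSet (hsPerp e (E : Set (H →L[ℂ] H))) →
      a ∈ expSet (E : Set (H →L[ℂ] H)) → ∀ ε > (0:ℝ), ∃ δ > (0:ℝ),
        ∀ k' b' a' : H →L[ℂ] H, MemU2 e k' →
          b' ∈ expSet (hsPerp e (E : Set (H →L[ℂ] H))) →
          a' ∈ expSet (E : Set (H →L[ℂ] H)) →
          hsNorm e (k' * b' * a' - k * b * a) < δ →
            hsNorm e (k' - k) < ε ∧ hsNorm e (b' - b) < ε ∧ hsNorm e (a' - a) < ε) := by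
  have hK : LTS (EK e E) := lts_EK hE hclosed hbrk
  simp only [mem_expSet_E hE, mem_expSet_F hE]
  have hpr : ∀ k b a : H →L[ℂ] H, MemU2 e k →
      (∃ C : HSp e, Sa C ∧ (∀ X ∈ EK e E, ⟪X, C⟫_ℝ = 0) ∧ b = eh C) →
      (∃ Z ∈ EK e E, a = eh Z) → MemGL2 e (k * b * a) := by
    rintro k _ _ hk ⟨C, hC, hCK, rfl⟩ ⟨Z, hZ, rfl⟩
    exact (hk.gl.mul (memGL2_eh C)).mul (memGL2_eh Z)
  refine ⟨hpr, ?_, ?_, ?_⟩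
  · intro x hx
    obtain ⟨c, hc, hcx⟩ := exists_log hx
    obtain ⟨Z, hZ, C, hC, hCK, hcd⟩ := hK.exists_decomp hc
    have hZs := hK.sa Z hZ
    have hk : MemU2 e (x * en Z * en C) := by
      have hgl : MemGL2 e (x * en Z * en C) := (hx.mul (memGL2_en Z)).mul (memGL2_en C)
      refine ⟨?_, hgl.2⟩
      have h1 : star (x * en Z * en C) * (x * en Z * en C) = 1 := by
        rw [star_mul, star_mul, hZs.en, hC.en,
          show en C * (en Z * star x) * (x * en Z * en C) = en C * (en Z * (star x * x) * en Z) * en C by noncomm_ring,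
          ← hcx, ← hcd, ex_act (memGL2_eh Z) hC, hZs.eh, ← eh_mul_eh C,
          show en C * (en Z * (eh Z * (eh C * eh C) * eh Z) * en Z) * en C =
            en C * ((en Z * eh Z) * (eh C * eh C) * (eh Z * en Z)) * en C by noncomm_ring, eh_mul_en, en_mul_eh,
          one_mul, mul_one, ← mul_assoc, en_mul_eh, one_mul, eh_mul_en]
      rw [Unitary.mem_iff]
      refine ⟨h1, ?_⟩
      obtain ⟨u, hu⟩ := hgl.1
      rw [← hu] at h1 ⊢
      have h2 : star (u : H →L[ℂ] H) = ((u⁻¹ : (H →L[ℂ] H)ˣ) : H →L[ℂ] H) := by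
        calc star (u : H →L[ℂ] H) = (star (u : H →L[ℂ] H) * u) * (u⁻¹ : (H →L[ℂ] H)ˣ) := by simp
          _ = _ := by rw [h1, one_mul]
      rw [h2]; simp
    have hxe : x = x * en Z * en C * eh C * eh Z := by
      rw [mul_assoc _ (en C), en_mul_eh, mul_one, mul_assoc, en_mul_eh, mul_one]
    refine ⟨(x * en Z * en C, eh C, eh Z), ⟨hk, ⟨C, hC, hCK, rfl⟩, ⟨Z, hZ, rfl⟩, hxe⟩, ?_⟩
    rintro ⟨k', _, _⟩ ⟨hk', ⟨C', hC', hCK', hb'⟩, ⟨Z', hZ', ha'⟩, hx'⟩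
    dsimp only at hk' hb' ha' hx'
    subst hb' ha'
    have h3 : act (eh Z') C' = act (eh Z) C := by
      apply ex_injective (act_sa _ _) (act_sa _ _)
      rw [hcd, hcx, ← star_mul_prod hk' (hK.sa _ hZ') hC', ← hx']
    obtain ⟨rfl, rfl⟩ := hK.unique_decomp hZ' hC' hCK' hZ hC hCK h3
    rw [hx', prod_cancel]
  · rintro k b a hk hb ha ε hε
    by_contra! hcon
    choose k' b' a' hk' hb' ha' h1 h2 h3 h4 using fun n : ℕ => hcon (1 / ((n:ℝ) + 1)) (by positivity)
    have glb : ∀ b : H →L[ℂ] H, (∃ C : HSp e, Sa C ∧ (∀ X ∈ EK e E, ⟪X, C⟫_ℝ = 0) ∧ b = eh C) → MemGL2 e b := by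
      rintro _ ⟨C, -, -, rfl⟩; exact memGL2_eh C
    have gla : ∀ a : H →L[ℂ] H, (∃ Z ∈ EK e E, a = eh Z) → MemGL2 e a := by
      rintro _ ⟨C, -, rfl⟩; exact memGL2_eh C
    have t1 := htend_of_hsNorm (fun n => (hk' n).gl) hk.gl h1
    have t2 := htend_of_hsNorm (fun n => glb _ (hb' n)) (glb _ hb) h2
    have t3 := htend_of_hsNorm (fun n => gla _ (ha' n)) (gla _ ha) h3
    have t4 := ((t1.mul t2).mul t3).hsNorm
    obtain ⟨n, hn⟩ := (t4.eventually_lt_const hε).exists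
    exact absurd (h4 n) (not_le.2 hn)
  · rintro k b a hk hb ha ε hε
    by_contra! hcon
    choose k' b' a' hk' hb' ha' h1 h2 using fun n : ℕ => hcon (1 / ((n:ℝ) + 1)) (by positivity)
    have t1 := htend_of_hsNorm (fun n => hpr _ _ _ (hk' n) (hb' n) (ha' n)) (hpr _ _ _ hk hb ha) h1
    obtain ⟨C, hC, hCK, rfl⟩ := hb
    obtain ⟨Z, hZ, rfl⟩ := ha
    choose C' hC' hCK' hbe using hb'
    choose Z' hZ' hae using ha'
    obtain rfl := funext hbe
    obtain rfl := funext hae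
    have t2 := t1.star.mul t1
    rw [star_mul_prod hk (hK.sa _ hZ) hC] at t2
    simp only [fun n => star_mul_prod (hk' n) (hK.sa _ (hZ' n)) (hC' n)] at t2
    have t3 := tendsto_of_htend_ex (fun _ => act_sa _ _) (act_sa _ _) t2
    obtain ⟨tZ, tC⟩ := hK.tendsto_decomp hZ' hC' hCK' hZ hC hCK t3
    have t4 := (t1.mul (htend_en tZ)).mul (htend_en tC)
    simp only [prod_cancel] at t4
    obtain ⟨n, hn1, hn2, hn3⟩ := ((t4.hsNorm.eventually_lt_const hε).and
      (((htend_eh tC).hsNorm.eventually_lt_const hε).and ((htend_eh tZ).hsNorm.eventually_lt_const hε))).exists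
    exact absurd (h2 n hn1 hn2) (not_le.2 hn3)
end
end

section
/- For every p ∈ P, the map s_p : P → P defined by s_p(x) = p x⁻¹ p is a well-defined involution of P fixing p, and it is an isometry for the geodesic distance: d(p x⁻¹ p, p y⁻¹ p) = d(x, y) for all x, y ∈ P. In particular the inversion x ↦ x⁻¹ is a d-isometry of P, so P is a symmetric space. -/
noncomputable section

open scoped InnerProductSpace

variable {H : Type*} [NormedAddCommGroup H] [InnerProductSpace ℂ H] [CompleteSpace H]
variable {ι : Type*}

/-- extended-valued squared Hilbert–Schmidt norm -/
def hsE (e : HilbertBasis ι ℂ H) (A : H →L[ℂ] H) : ENNReal := ∑' i, ENNReal.ofReal (‖A (e i)‖ ^ 2)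

lemma isHS_iff (e : HilbertBasis ι ℂ H) (A : H →L[ℂ] H) : IsHS e A ↔ hsE e A ≠ ⊤ := by
  unfold IsHS hsE
  constructor
  · intro h
    exact h.tsum_ofReal_ne_top
  · intro h
    have := ENNReal.summable_toReal h
    refine this.congr fun i => ?_
    rw [ENNReal.toReal_ofReal (by positivity)]

lemma hsNorm_eq (e : HilbertBasis ι ℂ H) (A : H →L[ℂ] H) :
    hsNorm e A = Real.sqrt (hsE e A).toReal := by
  unfold hsNorm hsE
  rw [ENNReal.tsum_toReal_eq (fun _ => ENNReal.ofReal_ne_top)]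
  congr 2
  funext i
  rw [ENNReal.toReal_ofReal (by positivity)]

lemma parseval (e : HilbertBasis ι ℂ H) (x : H) :
    ENNReal.ofReal (‖x‖ ^ 2) = ∑' j, ENNReal.ofReal (‖(inner ℂ (e j) x : ℂ)‖ ^ 2) := by
  have h := e.hasSum_inner_mul_inner x x
  have h2 : HasSum (fun j => ‖(inner ℂ (e j) x : ℂ)‖ ^ 2) (‖x‖ ^ 2) := by
    have h3 := Complex.hasSum_re h
    have e1 : ((inner ℂ x x : ℂ)).re = ‖x‖ ^ 2 := by
      have := inner_self_eq_norm_sq (𝕜 := ℂ) x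
      simpa using this
    rw [e1] at h3
    refine h3.congr_fun ?_ |> fun h => h
    intro j
    rw [← inner_conj_symm x (e j), mul_comm, Complex.mul_conj, Complex.ofReal_re,
      Complex.normSq_eq_norm_sq]
  rw [← h2.tsum_eq, ENNReal.ofReal_tsum_of_nonneg (fun _ => by positivity) h2.summable]

lemma hsE_star (e : HilbertBasis ι ℂ H) (A : H →L[ℂ] H) : hsE e (star A) = hsE e A := by
  unfold hsE
  simp_rw [parseval e]
  rw [ENNReal.tsum_comm]
  refine tsum_congr fun i => tsum_congr fun j => ?_
  rw [ContinuousLinearMap.star_eq_adjoint, ContinuousLinearMap.adjoint_inner_right,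
    norm_inner_symm]

lemma hsE_mul_left (e : HilbertBasis ι ℂ H) (A B : H →L[ℂ] H) :
    hsE e (A * B) ≤ ENNReal.ofReal (‖A‖ ^ 2) * hsE e B := by
  unfold hsE
  rw [← ENNReal.tsum_mul_left]
  refine ENNReal.tsum_le_tsum fun i => ?_
  rw [← ENNReal.ofReal_mul (by positivity), ← mul_pow]
  refine ENNReal.ofReal_le_ofReal ?_
  gcongr
  exact A.le_opNorm _

lemma isHS_star {e : HilbertBasis ι ℂ H} {A : H →L[ℂ] H} (h : IsHS e A) : IsHS e (star A) := by
  rw [isHS_iff] at *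
  rwa [hsE_star]

lemma isHS_mul_left {e : HilbertBasis ι ℂ H} (A : H →L[ℂ] H) {B : H →L[ℂ] H} (h : IsHS e B) :
    IsHS e (A * B) := by
  rw [isHS_iff] at *
  exact ne_top_of_le_ne_top (ENNReal.mul_ne_top ENNReal.ofReal_ne_top h) (hsE_mul_left e A B)

lemma isHS_mul_right {e : HilbertBasis ι ℂ H} {A : H →L[ℂ] H} (B : H →L[ℂ] H) (h : IsHS e A) :
    IsHS e (A * B) := by
  have := isHS_star (isHS_mul_left (star B) (isHS_star h))
  simpa using this

lemma isHS_add {e : HilbertBasis ι ℂ H} {A B : H →L[ℂ] H} (hA : IsHS e A) (hB : IsHS e B) :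
    IsHS e (A + B) := by
  unfold IsHS at *
  refine Summable.of_nonneg_of_le (fun _ => by positivity) (fun i => ?_)
    ((hA.mul_left 2).add (hB.mul_left 2))
  have h1 : ‖(A + B) (e i)‖ ≤ ‖A (e i)‖ + ‖B (e i)‖ := norm_add_le _ _
  have h2 : ‖(A + B) (e i)‖ ^ 2 ≤ (‖A (e i)‖ + ‖B (e i)‖) ^ 2 := by gcongr
  nlinarith [sq_nonneg (‖A (e i)‖ - ‖B (e i)‖)]

lemma hsE_isom (e : HilbertBasis ι ℂ H) (U A : H →L[ℂ] H) (hU : star U * U = 1) :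
    hsE e (U * A) = hsE e A := by
  unfold hsE
  refine tsum_congr fun i => ?_
  have : ‖U (A (e i))‖ = ‖A (e i)‖ := by
    rw [ContinuousLinearMap.norm_map_iff_adjoint_comp_self U |>.mpr]
    exact hU
  rw [mul_apply_eq_comp, this]

lemma hsNorm_conj (e : HilbertBasis ι ℂ H) (U A : H →L[ℂ] H) (hU : star U * U = 1) :
    hsNorm e (U * A * star U) = hsNorm e A := by
  rw [hsNorm_eq, hsNorm_eq, mul_assoc, hsE_isom e _ _ hU, ← hsE_star, star_mul, star_star,
    hsE_isom e _ _ hU, hsE_star]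

lemma hsNorm_neg (e : HilbertBasis ι ℂ H) (A : H →L[ℂ] H) : hsNorm e (-A) = hsNorm e A := by
  simp [hsNorm]

lemma memP_iff (e : HilbertBasis ι ℂ H) (p : H →L[ℂ] H) :
    MemP e p ↔ IsStrictlyPositive p ∧ IsHS e (p - 1) := by
  unfold MemP
  rw [IsStrictlyPositive.iff_of_unital, ContinuousLinearMap.nonneg_iff_isPositive,
    ContinuousLinearMap.isPositive_def']
  constructor
  · rintro ⟨h1, h2, h3, h4⟩
    exact ⟨⟨⟨h1, h3⟩, h2⟩, h4⟩
  · rintro ⟨⟨⟨h1, h3⟩, h2⟩, h4⟩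
    exact ⟨h1, h2, h3, h4⟩

lemma sp_inverse {x : H →L[ℂ] H} (hx : IsStrictlyPositive x) :
    IsStrictlyPositive (Ring.inverse x) := by
  obtain ⟨u, rfl⟩ := hx.isUnit
  rw [Ring.inverse_unit]
  exact (u⁻¹).isUnit.isStrictlyPositive (CFC.inv_nonneg_of_nonneg u hx.nonneg)

lemma sp_conj {p x : H →L[ℂ] H} (hp : IsStrictlyPositive p) (hx : IsStrictlyPositive x) :
    IsStrictlyPositive (p * x * p) :=
  IsStrictlyPositive.conjugate_of_isUnit_of_isSelfAdjoint x p hp.isUnit hp.isSelfAdjoint hx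

lemma contOn_log {z : H →L[ℂ] H} (hz : IsStrictlyPositive z) :
    ContinuousOn Real.log (spectrum ℝ z) :=
  Real.continuousOn_log.mono fun _ ht => (hz.spectrum_pos ht).ne'

lemma pinvsqrt_sa (x : H →L[ℂ] H) : star (pinvsqrt x) = pinvsqrt x :=
  (cfc_predicate (R := ℝ) (p := IsSelfAdjoint) _ x)

lemma pinvsqrt_mul {x : H →L[ℂ] H} (hx : IsStrictlyPositive x) :
    pinvsqrt x * x * pinvsqrt x = 1 := by
  have hsa : IsSelfAdjoint x := hx.isSelfAdjoint
  have hc : ContinuousOn (fun t : ℝ => (Real.sqrt t)⁻¹) (spectrum ℝ x) :=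
    Real.continuous_sqrt.continuousOn.inv₀
      fun t ht => (Real.sqrt_pos.2 (hx.spectrum_pos ht)).ne'
  unfold pinvsqrt
  nth_rewrite 2 [← cfc_id' ℝ x]
  rw [← cfc_mul _ (fun t : ℝ => t) x hc continuousOn_id, 
    ← cfc_mul (fun t : ℝ => (Real.sqrt t)⁻¹ * t) _ x (hc.mul continuousOn_id) hc,
    ← cfc_one ℝ x]
  refine cfc_congr fun t ht => ?_
  have h0 := hx.spectrum_pos ht
  have h1 := Real.sqrt_pos.2 h0
  have h2 := Real.mul_self_sqrt h0.le
  simp only [Pi.one_apply]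
  field_simp
  nlinarith

lemma pinvsqrt_unit {x : H →L[ℂ] H} (hx : IsStrictlyPositive x) :
    ∃ a : (H →L[ℂ] H)ˣ, (a : H →L[ℂ] H) = pinvsqrt x ∧ star (a : H →L[ℂ] H) = a ∧
      (a : H →L[ℂ] H) * x * a = 1 := by
  have h := pinvsqrt_mul hx
  have h' : pinvsqrt x * (x * pinvsqrt x) = 1 := by rw [← mul_assoc, h]
  have : IsUnit (pinvsqrt x) := by
    refine ⟨⟨pinvsqrt x, x * pinvsqrt x, h', ?_⟩, rfl⟩
    rw [← left_inv_eq_right_inv h h', h]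
  obtain ⟨a, ha⟩ := this
  exact ⟨a, ha, by rw [ha, pinvsqrt_sa], by rw [ha, h]⟩

lemma sp_mid {x y : H →L[ℂ] H} (hx : IsStrictlyPositive x) (hy : IsStrictlyPositive y) :
    IsStrictlyPositive (pinvsqrt x * y * pinvsqrt x) := by
  obtain ⟨a, ha, hs, -⟩ := pinvsqrt_unit hx
  rw [← ha]
  exact IsStrictlyPositive.conjugate_of_isUnit_of_isSelfAdjoint y a a.isUnit hs hy

lemma plog_conj {U z : H →L[ℂ] H} (hz : IsStrictlyPositive z) (h1 : star U * U = 1)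
    (h2 : U * star U = 1) : plog (U * z * star U) = U * plog z * star U := by
  have hU : U ∈ unitary (H →L[ℂ] H) := Unitary.mem_iff.2 ⟨h1, h2⟩
  have hsa : IsSelfAdjoint z := hz.isSelfAdjoint
  have := StarAlgHomClass.map_cfc (S := ℂ) (Unitary.conjStarAlgAut ℂ (H →L[ℂ] H) ⟨U, hU⟩)
    Real.log z (contOn_log hz)
    (by
      change Continuous fun w => U * w * star U
      fun_prop) hsa (hsa.conjugate U)
  exact this.symm

lemma plog_inv {z : (H →L[ℂ] H)ˣ} (hz : IsStrictlyPositive (z : H →L[ℂ] H)) :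
    plog (↑z⁻¹ : H →L[ℂ] H) = - plog (z : H →L[ℂ] H) := by
  have hsa : IsSelfAdjoint (z : H →L[ℂ] H) := hz.isSelfAdjoint
  unfold plog
  rw [← cfc_comp_inv Real.log z ?_ hsa, ← cfc_neg]
  · simp only [Real.log_inv]
  · refine Real.continuousOn_log.mono ?_
    rintro _ ⟨t, ht, rfl⟩
    exact inv_ne_zero (hz.spectrum_pos ht).ne'

lemma isUnit_unitary {U : H →L[ℂ] H} (hU : IsUnit U) (h : U * star U = 1) : star U * U = 1 := by
  obtain ⟨u, rfl⟩ := hU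
  have : star (u : H →L[ℂ] H) = ↑u⁻¹ := (Units.inv_eq_of_mul_eq_one_right h).symm
  rw [this, Units.inv_mul]

lemma gdist_conj (e : HilbertBasis ι ℂ H) {g x y : H →L[ℂ] H} (hg : IsStrictlyPositive g)
    (hx : IsStrictlyPositive x) (hy : IsStrictlyPositive y) :
    gdist e (g * x * g) (g * y * g) = gdist e x y := by
  have hz := sp_mid hx hy
  obtain ⟨a, ha, hsa, haa⟩ := pinvsqrt_unit hx
  obtain ⟨b, hb, hsb, hbb⟩ := pinvsqrt_unit (sp_conj hg hx)
  unfold gdist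
  rw [← ha] at hz ⊢
  rw [← hb]
  have hsg : star g = g := hg.isSelfAdjoint
  obtain ⟨g, rfl⟩ := hg.isUnit
  set U : H →L[ℂ] H := ↑(b * g * a⁻¹) with hUdef
  have hsai : star (↑a⁻¹ : H →L[ℂ] H) = ↑a⁻¹ := by
    have : star a = a := Units.ext hsa
    rw [← Units.coe_star, star_inv, this]
  have hxe : x = ↑a⁻¹ * ↑a⁻¹ := by
    calc x = ↑a⁻¹ * (↑a * x * ↑a) * ↑a⁻¹ := by simp [mul_assoc]
      _ = _ := by rw [haa, mul_one]
  have hUs : star U = ↑a⁻¹ * g * b := by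
    simp [hUdef, hsai, hsb, hsg, mul_assoc]
  have h2 : U * star U = 1 := by
    rw [hUs, ← hbb, hxe, hUdef]
    simp [mul_assoc]
  have h1 := isUnit_unitary (Units.isUnit _) h2
  have key : (b : H →L[ℂ] H) * (g * y * g) * b = U * (a * y * a) * star U := by
    rw [hUs, hUdef]
    simp [mul_assoc]
  rw [key, plog_conj hz h1 h2, hsNorm_conj e _ _ h1]

lemma gdist_inv (e : HilbertBasis ι ℂ H) {x y : H →L[ℂ] H}
    (hx : IsStrictlyPositive x) (hy : IsStrictlyPositive y) :
    gdist e (Ring.inverse x) (Ring.inverse y) = gdist e x y := by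
  have hz := sp_mid hx hy
  obtain ⟨a, ha, hsa, haa⟩ := pinvsqrt_unit hx
  obtain ⟨b, hb, hsb, hbb⟩ := pinvsqrt_unit (sp_inverse hx)
  unfold gdist
  rw [← ha] at hz ⊢
  rw [← hb]
  obtain ⟨x, rfl⟩ := hx.isUnit
  obtain ⟨y, rfl⟩ := hy.isUnit
  rw [Ring.inverse_unit] at *
  have hxe : x⁻¹ = a * a := by
    have : a * x * a = 1 := Units.ext haa
    have h3 : x = a⁻¹ * a⁻¹ := by
      calc x = a⁻¹ * (a * x * a) * a⁻¹ := by group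
        _ = _ := by rw [this, mul_one]
    rw [h3, mul_inv_rev, inv_inv]
  set U : H →L[ℂ] H := ↑(b * a) with hUdef
  have hUs : star U = a * b := by
    simp [hUdef, hsa, hsb]
  have h2 : U * star U = 1 := by
    rw [hUs, ← hbb, hxe, hUdef]
    simp [mul_assoc]
  have h1 := isUnit_unitary (Units.isUnit _) h2
  have key : (b : H →L[ℂ] H) * ↑y⁻¹ * b = U * ↑(a * y * a)⁻¹ * star U := by
    rw [hUs, hUdef]
    simp [mul_assoc]
  have hz' : IsStrictlyPositive ((a * y * a : (H →L[ℂ] H)ˣ) : H →L[ℂ] H) := by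
    simpa using hz
  have hzi : IsStrictlyPositive (↑(a * y * a)⁻¹ : H →L[ℂ] H) := by
    rw [← Ring.inverse_unit]; exact sp_inverse hz'
  rw [key, plog_conj hzi h1 h2, hsNorm_conj e _ _ h1, plog_inv hz', hsNorm_neg]
  simp

lemma memP_inv {e : HilbertBasis ι ℂ H} {x : H →L[ℂ] H} (hx : MemP e x) :
    MemP e (Ring.inverse x) := by
  rw [memP_iff] at *
  refine ⟨sp_inverse hx.1, ?_⟩
  have h := Ring.inverse_mul_cancel x hx.1.isUnit
  have : Ring.inverse x - 1 = (-Ring.inverse x) * (x - 1) := by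
    rw [mul_sub, neg_mul, h]; simp; abel
  rw [this]
  exact isHS_mul_left _ hx.2

lemma memP_conj {e : HilbertBasis ι ℂ H} {p x : H →L[ℂ] H} (hp : MemP e p) (hx : MemP e x) :
    MemP e (p * x * p) := by
  rw [memP_iff] at *
  refine ⟨sp_conj hp.1 hx.1, ?_⟩
  have : p * x * p - 1 = p * (x - 1) * p + (p * (p - 1) + (p - 1)) := by
    noncomm_ring
  rw [this]
  exact isHS_add (isHS_mul_right _ (isHS_mul_left _ hx.2))
    (isHS_add (isHS_mul_left _ hp.2) hp.2)

/-- For `p ∈ P`, the map `s_p(x) = p x⁻¹ p` is a well-defined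
involution of `P` fixing `p` which is an isometry for the geodesic distance; in
particular the inversion `x ↦ x⁻¹` is a `d`-isometry of `P` (so `P` is a symmetric
space). -/
theorem statement17 (e : HilbertBasis ι ℂ H) (p : H →L[ℂ] H) (hp : MemP e p) :
    (∀ x : H →L[ℂ] H, MemP e x → MemP e (p * Ring.inverse x * p)) ∧
    p * Ring.inverse p * p = p ∧
    (∀ x : H →L[ℂ] H, MemP e x → p * Ring.inverse (p * Ring.inverse x * p) * p = x) ∧
    (∀ x y : H →L[ℂ] H, MemP e x → MemP e y →
      gdist e (p * Ring.inverse x * p) (p * Ring.inverse y * p) = gdist e x y) ∧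
    (∀ x y : H →L[ℂ] H, MemP e x → MemP e y →
      MemP e (Ring.inverse x) ∧
      gdist e (Ring.inverse x) (Ring.inverse y) = gdist e x y) := by
  refine ⟨fun x hx => memP_conj hp (memP_inv hx), ?_, fun x hx => ?_, fun x y hx hy => ?_,
    fun x y hx hy => ⟨memP_inv hx, gdist_inv e ((memP_iff e x).1 hx).1 ((memP_iff e y).1 hy).1⟩⟩
  · rw [Ring.mul_inverse_cancel p hp.2.1, one_mul]
  · obtain ⟨p, rfl⟩ := hp.2.1
    obtain ⟨x, rfl⟩ := hx.2.1
    rw [Ring.inverse_unit, ← Units.val_mul, ← Units.val_mul, Ring.inverse_unit]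
    simp [mul_assoc]
  · have hp' := ((memP_iff e p).1 hp).1
    have hx' := ((memP_iff e x).1 hx).1
    have hy' := ((memP_iff e y).1 hy).1
    rw [gdist_conj e hp' (sp_inverse hx') (sp_inverse hy'), gdist_inv e hx' hy']
end
end
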